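/- For all integers k ≥ 3 and n ≥ 2, the abelianization of the fundamental group of F_{k+1}^{1,n} is isomorphic to the free abelian group ℤ^{m}, where m = (k choose 2) − 1. -/

import Mathlib

noncomputable section

open Module Submodule

/-- Topology on the projectivization (quotient topology). -/
instance (K V : Type*) [DivisionRing K] [AddCommGroup V] [Module K V] [TopologicalSpace V] :
    TopologicalSpace (Projectivization K V) :=
  inferInstanceAs (TopologicalSpace (Quotient (projectivizationSetoid K V)))

/-- The complex projective space `ℂP^n`. -/
abbrev CP (n : ℕ) := Projectivization ℂ (Fin (n + 1) → ℂ)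

/-- `Fconf k i n` is the ordered configuration space `F_k^{i,n}` of `k` pairwise distinct
points of `ℂP^n` whose projective span has dimension `i` (i.e. the span of representative
vectors has linear dimension `i + 1`). -/
def Fconf (k i n : ℕ) : Set (Fin k → CP n) :=
  {x | Function.Injective x ∧
    finrank ℂ (span ℂ (Set.range fun j => (x j).rep)) = i + 1}

section FirstHomology

open Set Topology Filter unitInterval

/-! ### Abelian `1`-cocycles on paths -/

/-- The bottom edge of the unit square. -/
def edgeBottom : C(I, I × I) := ⟨fun s => (s, 0), by fun_prop⟩
/-- The right edge of the unit square. -/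
def edgeRight : C(I, I × I) := ⟨fun t => (1, t), by fun_prop⟩
/-- The left edge of the unit square. -/
def edgeLeft : C(I, I × I) := ⟨fun t => (0, t), by fun_prop⟩
/-- The top edge of the unit square. -/
def edgeTop : C(I, I × I) := ⟨fun s => (s, 1), by fun_prop⟩

/-- A function on paths is a cocycle if it vanishes on constant paths and its sum over the
boundary of every singular square is zero. -/
structure IsCocycle {X A : Type*} [TopologicalSpace X] [AddCommGroup A] (c : C(I, X) → A) :
    Prop where
  const : ∀ x, c (.const I x) = 0
  square : ∀ H : C(I × I, X), c (H.comp edgeBottom) + c (H.comp edgeRight) =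
    c (H.comp edgeLeft) + c (H.comp edgeTop)

/-- A function on paths is exact on `U` if it is the increment of a potential
along all paths in `U`. -/
def ExactOn {X A : Type*} [TopologicalSpace X] [AddCommGroup A] (c : C(I, X) → A)
    (U : Set X) : Prop :=
  ∃ g : X → A, ∀ γ : C(I, X), (∀ t, γ t ∈ U) → c γ = g (γ 1) - g (γ 0)

/-- A function on paths is exact if it is the increment of a potential. -/
def IsExact {X A : Type*} [TopologicalSpace X] [AddCommGroup A] (c : C(I, X) → A) : Prop :=
  ∃ g : X → A, ∀ γ : C(I, X), c γ = g (γ 1) - g (γ 0)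

section Basic

variable {X Y Z A : Type*} [TopologicalSpace X] [TopologicalSpace Y] [TopologicalSpace Z]
  [AddCommGroup A]

lemma ExactOn.isExact {c : C(I, X) → A} {U : Set X} (h : ExactOn c U) (hU : ∀ x, x ∈ U) :
    IsExact c :=
  let ⟨g, hg⟩ := h; ⟨g, fun γ => hg γ fun _ => hU _⟩

lemma IsExact.loop_eq_zero {c : C(I, X) → A} (h : IsExact c) {γ : C(I, X)} (hγ : γ 0 = γ 1) :
    c γ = 0 := by
  obtain ⟨g, hg⟩ := h
  rw [hg, hγ, sub_self]

lemma IsCocycle.pullback {c : C(I, X) → A} (hc : IsCocycle c) (f : C(Y, X)) :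
    IsCocycle fun γ : C(I, Y) => c (f.comp γ) where
  const y := hc.const (f y)
  square H := hc.square (f.comp H)

lemma IsCocycle.sub {c d : C(I, X) → A} (hc : IsCocycle c) (hd : IsCocycle d) :
    IsCocycle fun γ => c γ - d γ where
  const x := by simp [hc.const, hd.const]
  square H := by
    have h₁ := hc.square H
    have h₂ := hd.square H
    rw [← eq_sub_iff_add_eq] at h₁ h₂
    rw [h₁, h₂]; abel

lemma IsCocycle.smul {c : C(I, X) → ℤ} (hc : IsCocycle c) (a : A) :
    IsCocycle fun γ => c γ • a where
  const x := by simp [hc.const]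
  square H := by rw [← add_smul, ← add_smul, hc.square]

lemma IsCocycle.sum {ι : Type*} (s : Finset ι) {c : ι → C(I, X) → A}
    (hc : ∀ i ∈ s, IsCocycle (c i)) : IsCocycle fun γ => ∑ i ∈ s, c i γ where
  const x := Finset.sum_eq_zero fun i hi => (hc i hi).const x
  square H := by
    rw [← Finset.sum_add_distrib, ← Finset.sum_add_distrib]
    exact Finset.sum_congr rfl fun i hi => (hc i hi).square H

/-- The reparametrized restriction of a path to the interval from `a` to `b`. -/
def subpath (γ : C(I, X)) (a b : ℝ) : C(I, X) :=
  ⟨fun s => γ (projIcc 0 1 zero_le_one (a + s * (b - a))),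
    γ.continuous.comp (continuous_projIcc.comp (by fun_prop))⟩

lemma subpath_zero_one (γ : C(I, X)) : subpath γ 0 1 = γ := by
  ext s; simp [subpath]

lemma subpath_apply_zero (γ : C(I, X)) (a b : ℝ) :
    subpath γ a b 0 = γ (projIcc 0 1 zero_le_one a) := by simp [subpath]

lemma subpath_apply_one (γ : C(I, X)) (a b : ℝ) :
    subpath γ a b 1 = γ (projIcc 0 1 zero_le_one b) := by simp [subpath]

lemma IsCocycle.subpath_add {c : C(I, X) → A} (hc : IsCocycle c) (γ : C(I, X)) (a b d : ℝ) :
    c (subpath γ a b) + c (subpath γ b d) = c (subpath γ a d) := by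
  let H : C(I × I, X) :=
    ⟨fun p => γ (projIcc 0 1 zero_le_one (a + p.1 * (b + p.2 * (d - b) - a))),
      γ.continuous.comp (continuous_projIcc.comp (by fun_prop))⟩
  have h := hc.square H
  have hb : H.comp edgeBottom = subpath γ a b := by
    ext s; simp [H, edgeBottom, subpath]
  have hr : H.comp edgeRight = subpath γ b d := by
    ext s; simp [H, edgeRight, subpath]
  have hl : H.comp edgeLeft = .const I (γ (projIcc 0 1 zero_le_one a)) := by
    ext s; simp [H, edgeLeft]
  have ht : H.comp edgeTop = subpath γ a d := by
    ext s; simp [H, edgeTop, subpath]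
  rwa [hb, hr, hl, ht, hc.const, zero_add] at h

lemma projIcc_mem_Icc {a b : I} {s : I} (hab : a ≤ b) :
    projIcc (0 : ℝ) 1 zero_le_one (a + s * ((b : ℝ) - a)) ∈ Icc a b := by
  have hab' : (a : ℝ) ≤ b := hab
  have h1 : (a : ℝ) ≤ a + s * ((b : ℝ) - a) := by nlinarith [s.2.1]
  have h2 : a + s * ((b : ℝ) - a) ≤ (b : ℝ) := by nlinarith [s.2.2]
  rw [projIcc_of_mem zero_le_one ⟨a.2.1.trans h1, h2.trans b.2.2⟩]
  exact ⟨h1, h2⟩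

/-- Being the increment of a given potential is a local property of cocycles. -/
lemma IsCocycle.eq_increment_of_local {c : C(I, X) → A} (hc : IsCocycle c) (g : X → A)
    (γ : C(I, X)) (h : ∀ t, ∃ U ∈ 𝓝 (γ t), ∀ δ : C(I, X), (∀ s, δ s ∈ U) →
      c δ = g (δ 1) - g (δ 0)) : c γ = g (γ 1) - g (γ 0) := by
  choose U hU hUc using h
  obtain ⟨τ, hτ0, hτm, ⟨N, hN⟩, hτ⟩ := exists_monotone_Icc_subset_open_cover_unitInterval
    (c := fun t => γ ⁻¹' interior (U t)) (fun t => isOpen_interior.preimage γ.continuous)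
    (fun t _ => mem_iUnion.2 ⟨t, mem_interior_iff_mem_nhds.2 (hU t)⟩)
  have hp : ∀ t : I, projIcc (0 : ℝ) 1 zero_le_one (t : ℝ) = t := fun t => projIcc_val _ t
  have key : ∀ n, c (subpath γ 0 (τ n)) = g (γ (τ n)) - g (γ 0) := by
    intro n
    induction n with
    | zero =>
      have : subpath γ 0 (τ 0) = .const I (γ 0) := by ext s; simp [subpath, hτ0]
      rw [this, hc.const, hτ0, sub_self]
    | succ n ih =>
      obtain ⟨i, hi⟩ := hτ n
      rw [← hc.subpath_add γ 0 (τ n), ih, hUc i (subpath γ (τ n) (τ (n + 1)))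
        (fun s => interior_subset (hi (projIcc_mem_Icc (hτm n.le_succ)))), subpath_apply_one,
        subpath_apply_zero, hp, hp]
      abel
  have := key N
  rwa [hN N le_rfl, Icc.coe_one, subpath_zero_one] at this

lemma exactOn_of_pullback {c : C(I, X) → A} {U : Set X}
    (h : IsExact fun γ : C(I, U) => c (ContinuousMap.comp ⟨Subtype.val, by fun_prop⟩ γ)) :
    ExactOn c U := by
  classical
  obtain ⟨g, hg⟩ := h
  refine ⟨fun x => if hx : x ∈ U then g ⟨x, hx⟩ else 0, fun γ hγ => ?_⟩
  have := hg ⟨fun t => ⟨γ t, hγ t⟩, by fun_prop⟩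
  simp only [hγ, dif_pos]
  exact this

/-- Locally homotopic maps pull a cocycle back to cohomologous cocycles, as soon as the
integrals along the local homotopies fit together. -/
lemma IsCocycle.eq_add_of_local_homotopy {c : C(I, X) → A} (hc : IsCocycle c) (f₀ f₁ : C(Z, X))
    (g : Z → A) (h : ∀ z, ∃ U ∈ 𝓝 z, ∃ H : C(U × I, X), (∀ u, H (u, 0) = f₀ u.1) ∧
      (∀ u, H (u, 1) = f₁ u.1) ∧ ∀ u, c ⟨fun t => H (u, t), by fun_prop⟩ = g u.1)
    (γ : C(I, Z)) : c (f₁.comp γ) = c (f₀.comp γ) + (g (γ 1) - g (γ 0)) := by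
  rw [← sub_eq_iff_eq_add']
  refine ((hc.pullback f₁).sub (hc.pullback f₀)).eq_increment_of_local g γ fun t => ?_
  obtain ⟨U, hU, H, h0, h1, hg⟩ := h (γ t)
  refine ⟨U, hU, fun δ hδ => ?_⟩
  let K : C(I × I, X) := ⟨fun p => H (⟨δ p.1, hδ p.1⟩, p.2), by fun_prop⟩
  have hsq := hc.square K
  have hb : f₀.comp δ = K.comp edgeBottom := ContinuousMap.ext fun s => (h0 ⟨δ s, hδ s⟩).symm
  have ht : f₁.comp δ = K.comp edgeTop := ContinuousMap.ext fun s => (h1 ⟨δ s, hδ s⟩).symm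
  have hr : c (K.comp edgeRight) = g (δ 1) := hg ⟨δ 1, hδ 1⟩
  have hl : c (K.comp edgeLeft) = g (δ 0) := hg ⟨δ 0, hδ 0⟩
  rw [hr, hl] at hsq
  rw [hb, ht, sub_eq_sub_iff_add_eq_add, add_comm, ← hsq, add_comm]

/-- Homotopic maps pull a cocycle back to cohomologous cocycles. -/
lemma IsCocycle.isExact_of_homotopy {c : C(I, X) → A} (hc : IsCocycle c) (f₀ f₁ : C(Z, X))
    (H : C(Z × I, X)) (h0 : ∀ z, H (z, 0) = f₀ z) (h1 : ∀ z, H (z, 1) = f₁ z)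
    (he : IsExact fun γ : C(I, Z) => c (f₀.comp γ)) :
    IsExact fun γ : C(I, Z) => c (f₁.comp γ) := by
  obtain ⟨g, hg⟩ := he
  refine ⟨fun z => c ⟨fun t => H (z, t), by fun_prop⟩ + g z, fun γ => ?_⟩
  refine (hc.eq_add_of_local_homotopy f₀ f₁ (fun z => c ⟨fun t => H (z, t), by fun_prop⟩)
    (fun z => ⟨univ, univ_mem, ⟨fun p => H (p.1, p.2), by fun_prop⟩, fun u => h0 u, fun u => h1 u,
      fun u => rfl⟩) γ).trans ?_
  rw [show c (f₀.comp γ) = _ from hg γ]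
  beta_reduce
  abel

/-- Potentials on two open sets with path connected intersection glue. -/
lemma IsCocycle.exactOn_union {c : C(I, X) → A} (hc : IsCocycle c) {U V : Set X}
    (hU : IsOpen U) (hV : IsOpen V) (hcU : ExactOn c U) (hcV : ExactOn c V)
    (hUV : ∀ x ∈ U ∩ V, ∀ y ∈ U ∩ V, JoinedIn (U ∩ V) x y) : ExactOn c (U ∪ V) := by
  classical
  obtain ⟨g, hg⟩ := hcU
  obtain ⟨h, hh⟩ := hcV
  obtain ⟨a, ha⟩ : ∃ a, ∀ x ∈ U ∩ V, g x = h x + a := by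
    by_cases hne : (U ∩ V).Nonempty
    · obtain ⟨x₀, hx₀⟩ := hne
      refine ⟨g x₀ - h x₀, fun x hx => ?_⟩
      obtain ⟨p, hp⟩ := hUV x₀ hx₀ x hx
      have h1 := hg p (fun t => (hp t).1)
      have h2 := hh p (fun t => (hp t).2)
      simp only [ContinuousMap.coe_coe, Path.target, Path.source] at h1 h2
      rw [h1, sub_eq_sub_iff_add_eq_add] at h2
      rw [← add_sub_assoc, eq_sub_iff_add_eq, ← h2]
    · exact ⟨0, fun x hx => (hne ⟨x, hx⟩).elim⟩
  refine ⟨fun x => if x ∈ U then g x else h x + a, fun γ hγ => ?_⟩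
  refine hc.eq_increment_of_local (fun x => if x ∈ U then g x else h x + a) γ fun t => ?_
  rcases hγ t with ht | ht
  · refine ⟨U, hU.mem_nhds ht, fun δ hδ => ?_⟩
    simp only [hδ, if_true]
    exact hg δ hδ
  · have : ∀ x ∈ V, (if x ∈ U then g x else h x + a) = h x + a := fun x hx => by
      split_ifs with hxU
      · exact ha x ⟨hxU, hx⟩
      · rfl
    refine ⟨V, hV.mem_nhds ht, fun δ hδ => ?_⟩
    rw [this _ (hδ 1), this _ (hδ 0), hh δ hδ]
    abel

/-- Exactness descends along surjections with local sections. -/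
lemma IsCocycle.isExact_of_local_sections {c : C(I, X) → A} (hc : IsCocycle c) (q : C(Y, X))
    (hq : Function.Surjective q) (g : Y → A)
    (hg : ∀ γ : C(I, Y), c (q.comp γ) = g (γ 1) - g (γ 0))
    (hfib : ∀ y y', q y = q y' → g y = g y')
    (hs : ∀ x, ∃ U ∈ 𝓝 x, ∃ s : C(U, Y), ∀ u, q (s u) = u.1) : IsExact c := by
  choose r hr using hq
  refine ⟨fun x => g (r x), fun γ => ?_⟩
  refine hc.eq_increment_of_local (fun x => g (r x)) γ fun t => ?_
  obtain ⟨U, hU, s, hs⟩ := hs (γ t)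
  refine ⟨U, hU, fun δ hδ => ?_⟩
  have := hg (s.comp ⟨fun t => ⟨δ t, hδ t⟩, by fun_prop⟩)
  have e : q.comp (s.comp ⟨fun t => ⟨δ t, hδ t⟩, by fun_prop⟩) = δ :=
    ContinuousMap.ext fun t => hs _
  rw [e] at this
  rw [this]
  congr 1 <;> refine hfib _ _ ?_ <;> rw [hr] <;> exact hs _

/-- A cocycle on the total space of a family of open sets with connected fibres, exact on the
fibres, is cohomologous to the pullback of its restriction to a section. -/
lemma IsCocycle.exists_eq_section_add {B F : Type*} [TopologicalSpace B] [TopologicalSpace F]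
    [AddCommGroup F] [Module ℝ F] [IsTopologicalAddGroup F] [ContinuousSMul ℝ F]
    {E : Set (B × F)} (hE : IsOpen E) (sec : C(B, E)) (hs : ∀ b, (sec b).1.1 = b)
    {c : C(I, E) → A} (hc : IsCocycle c)
    (hconn : ∀ b, ∀ f ∈ {f | (b, f) ∈ E}, ∀ f' ∈ {f | (b, f) ∈ E}, JoinedIn {f | (b, f) ∈ E} f f')
    (hex : ∀ b, IsExact fun γ : C(I, {f // (b, f) ∈ E}) =>
      c ⟨fun t => ⟨(b, (γ t).1), (γ t).2⟩, by fun_prop⟩) :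
    ∃ g : E → A, ∀ γ : C(I, E),
      c γ = c (sec.comp ⟨fun t => (γ t).1.1, by fun_prop⟩) + (g (γ 1) - g (γ 0)) := by
  choose h hh using hex
  have hsE : ∀ b, (b, (sec b).1.2) ∈ E := fun b => by
    have := (sec b).2
    rwa [show (sec b).1 = (b, (sec b).1.2) from Prod.ext (hs b) rfl] at this
  let G : E → A := fun e => h e.1.1 ⟨e.1.2, e.2⟩ - h e.1.1 ⟨(sec e.1.1).1.2, hsE e.1.1⟩
  refine ⟨G, fun γ => hc.eq_add_of_local_homotopy
    (sec.comp ⟨fun e : E => e.1.1, by fun_prop⟩) (ContinuousMap.id E) G (fun e => ?_) γ⟩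
  obtain ⟨p, hp⟩ := hconn e.1.1 _ (hsE e.1.1) e.1.2 e.2
  let K : E × I → B × F := fun x => (x.1.1.1,
    p x.2 + ((1 - (x.2 : ℝ)) • ((sec x.1.1.1).1.2 - (sec e.1.1).1.2) +
      (x.2 : ℝ) • (x.1.1.2 - e.1.2)))
  have hK : Continuous K := by fun_prop
  have hnhds : ∀ᶠ e' in 𝓝 e, ∀ t ∈ (univ : Set I), K (e', t) ∈ E := by
    refine isCompact_univ.eventually_forall_of_forall_eventually fun t _ => ?_
    refine hK.continuousAt.preimage_mem_nhds (hE.mem_nhds ?_)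
    simpa [K] using hp t
  refine ⟨_, hnhds, ⟨fun x => ⟨K (x.1, x.2), x.1.2 x.2 (mem_univ _)⟩, by fun_prop⟩, fun u => ?_,
    fun u => ?_, fun u => ?_⟩
  · refine Subtype.ext (Prod.ext ?_ ?_)
    · exact (hs _).symm
    · simp [K]
  · refine Subtype.ext (Prod.ext rfl ?_)
    simp [K]
  · have := hh u.1.1.1 ⟨fun t => ⟨(K (u, t)).2, u.2 t (mem_univ _)⟩, by fun_prop⟩
    refine Eq.trans this ?_
    simp [G, K]

end Basic

section Star

variable {A F : Type*} [AddCommGroup A] [TopologicalSpace F] [AddCommGroup F] [Module ℝ F]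
  [IsTopologicalAddGroup F] [ContinuousSMul ℝ F]

/-- A cocycle on `O` is exact on the part of `O` visible from a given point. -/
lemma IsCocycle.exactOn_visible {O : Set F} {c : C(I, O) → A} (hc : IsCocycle c) (p : O) :
    ExactOn c {x : O | ∀ t : I, p.1 + (t : ℝ) • (x.1 - p.1) ∈ O} := by
  refine exactOn_of_pullback (hc.isExact_of_homotopy (ContinuousMap.const _ p) _
    ⟨fun y => ⟨p.1 + (y.2 : ℝ) • (y.1.1.1 - p.1), y.1.2 y.2⟩, by fun_prop⟩ (fun z => ?_)
    (fun z => ?_) ⟨0, fun γ => ?_⟩)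
  · simp
  · ext1; simp
  · simpa using hc.const p

lemma isOpen_visible {O : Set F} (hO : IsOpen O) (p : O) :
    IsOpen {x : O | ∀ t : I, p.1 + (t : ℝ) • (x.1 - p.1) ∈ O} := by
  rw [isOpen_iff_mem_nhds]
  intro x hx
  have : ∀ᶠ y : O in 𝓝 x, ∀ t ∈ (univ : Set I), p.1 + (t : ℝ) • (y.1 - p.1) ∈ O := by
    refine isCompact_univ.eventually_forall_of_forall_eventually fun t _ => ?_
    have hcont : Continuous fun z : O × I => p.1 + (z.2 : ℝ) • (z.1.1 - p.1) := by fun_prop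
    exact hcont.continuousAt.preimage_mem_nhds (hO.mem_nhds (hx t))
  filter_upwards [this] with y hy t using hy t (mem_univ t)

lemma IsCocycle.isExact_of_starConvex {O : Set F} {c : C(I, O) → A} (hc : IsCocycle c) {p : F}
    (hp : p ∈ O) (hO : StarConvex ℝ p O) : IsExact c :=
  (hc.exactOn_visible ⟨p, hp⟩).isExact fun x t => by
    have := hO x.2 (a := 1 - t) (b := t) (by simpa using t.2.2) t.2.1 (by ring)
    convert this using 1
    simp only [smul_sub, sub_smul, one_smul]; abel

end Star

/-- A path inside a subset of a subtype, from a path in the ambient space. -/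
lemma JoinedIn.subtype {X : Type*} [TopologicalSpace X] {O : Set X} {T : Set O} {x y : O}
    {S : Set X} (h : JoinedIn S x.1 y.1) (hS : ∀ z ∈ S, ∃ hz : z ∈ O, (⟨z, hz⟩ : O) ∈ T) :
    JoinedIn T x y := by
  obtain ⟨p, hp⟩ := h
  refine ⟨⟨⟨fun t => ⟨p t, (hS _ (hp t)).1⟩, by fun_prop⟩, Subtype.ext (by simp),
    Subtype.ext (by simp)⟩, fun t => (hS _ (hp t)).2⟩

section Complement

variable {A F : Type*} [AddCommGroup A] [NormedAddCommGroup F] [NormedSpace ℝ F]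

lemma finrank_sup_span_singleton_le (L : Submodule ℝ F) [FiniteDimensional ℝ F] (e : F) :
    finrank ℝ (L ⊔ ℝ ∙ e : Submodule ℝ F) ≤ finrank ℝ L + 1 :=
  (Submodule.finrank_add_le_finrank_add_finrank _ _).trans
    (Nat.add_le_add_left ((finrank_span_le_card {e}).trans (by simp)) _)

/-- The complement of a finite union of subspaces of real codimension at least two is path
connected. -/
lemma isPathConnected_compl_biUnion [FiniteDimensional ℝ F] {ι : Type*} [Finite ι]
    (L : ι → Submodule ℝ F) (hL : ∀ i, finrank ℝ (L i) + 1 < finrank ℝ F) :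
    IsPathConnected {x : F | ∀ i, x ∉ L i} := by
  classical
  have generic : ∀ u w : F, ∃ p, ∀ i, p ∉ L i ⊔ ℝ ∙ u ∧ p ∉ L i ⊔ ℝ ∙ w := by
    intro u w
    have := Fintype.ofFinite ι
    have hne := Subspace.biUnion_ne_univ_of_top_notMem
      (s := Finset.univ.image (fun i : ι × Bool => L i.1 ⊔ ℝ ∙ (if i.2 then u else w))) (by
        simp only [Finset.mem_image, Finset.mem_univ, true_and, not_exists]
        intro i hi
        have h1 := finrank_sup_span_singleton_le (L i.1) (if i.2 then u else w)
        rw [hi, finrank_top] at h1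
        have := hL i.1
        omega)
    obtain ⟨p, hp⟩ := (ne_univ_iff_exists_notMem _).1 hne
    simp only [mem_iUnion, not_exists] at hp
    refine ⟨p, fun i => ⟨hp _ (Finset.mem_image.2 ⟨(i, true), Finset.mem_univ _, by simp⟩),
      hp _ (Finset.mem_image.2 ⟨(i, false), Finset.mem_univ _, by simp⟩)⟩⟩
  have seg : ∀ u p : F, (∀ i, u ∉ L i) → (∀ i, p ∉ L i ⊔ ℝ ∙ u) →
      JoinedIn {x : F | ∀ i, x ∉ L i} u p := by
    intro u p hu hp
    refine JoinedIn.of_segment_subset ?_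
    rintro _ ⟨a, b, ha, hb, hab, rfl⟩ i hi
    by_cases hb0 : b = 0
    · subst hb0
      obtain rfl : a = 1 := by linarith
      exact hu i (by simpa using hi)
    · refine hp i ?_
      have h1 : b • p ∈ L i ⊔ ℝ ∙ u := by
        have : b • p = (a • u + b • p) + (-a) • u := by rw [neg_smul]; abel
        rw [this]
        exact Submodule.add_mem _ (mem_sup_left hi)
          (mem_sup_right (Submodule.smul_mem _ _ (mem_span_singleton_self u)))
      exact (Submodule.smul_mem_iff _ hb0).1 h1
  obtain ⟨p₀, hp₀⟩ := generic 0 0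
  refine ⟨p₀, fun i hi => (hp₀ i).1 (mem_sup_left hi), fun {y} hy => ?_⟩
  have hp₀' : ∀ i, p₀ ∉ L i := fun i hi => (hp₀ i).1 (mem_sup_left hi)
  obtain ⟨p, hp⟩ := generic p₀ y
  exact (seg p₀ p hp₀' fun i => (hp i).1).trans (seg y p hy fun i => (hp i).2).symm

/-- Cocycles on the complement of a subspace of real codimension at least three are exact. -/
lemma IsCocycle.isExact_compl_submodule [FiniteDimensional ℝ F] (L : Submodule ℝ F)
    (hL : finrank ℝ L + 2 < finrank ℝ F) {c : C(I, {x : F | x ∉ L}) → A} (hc : IsCocycle c) :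
    IsExact c := by
  have hLo : IsOpen {x : F | x ∉ L} := L.closed_of_finiteDimensional.isOpen_compl
  obtain ⟨e, he⟩ : ∃ e, e ∉ L := by
    by_contra! h
    have : L = ⊤ := eq_top_iff.2 fun x _ => h x
    rw [this, finrank_top] at hL
    omega
  have hne : -e ∉ L := fun h => he (by simpa using L.neg_mem h)
  refine (hc.exactOn_union (isOpen_visible hLo ⟨e, he⟩) (isOpen_visible hLo ⟨-e, hne⟩)
    (hc.exactOn_visible _) (hc.exactOn_visible _) ?_).isExact ?_
  · intro x hx y hy
    have key : ∀ z : {x : F | x ∉ L}, z.1 ∉ L ⊔ ℝ ∙ e ↔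
        z ∈ {x : {x : F | x ∉ L} | ∀ t : I, e + (t : ℝ) • (x.1 - e) ∈ {x : F | x ∉ L}} ∩
          {x : {x : F | x ∉ L} | ∀ t : I, -e + (t : ℝ) • (x.1 - -e) ∈ {x : F | x ∉ L}} := by
      intro z
      constructor
      · intro hz
        refine ⟨fun t ht => hz ?_, fun t ht => hz ?_⟩
        · have ht0 : (t : ℝ) ≠ 0 := fun h => he (by simpa [h] using ht)
          refine (Submodule.smul_mem_iff _ ht0).1 ?_
          have : (t : ℝ) • z.1 = (e + (t : ℝ) • (z.1 - e)) + ((t : ℝ) - 1) • e := by module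
          rw [this]
          exact Submodule.add_mem _ (mem_sup_left ht)
            (mem_sup_right (Submodule.smul_mem _ _ (mem_span_singleton_self e)))
        · have ht0 : (t : ℝ) ≠ 0 := fun h => hne (by simpa [h] using ht)
          refine (Submodule.smul_mem_iff _ ht0).1 ?_
          have : (t : ℝ) • z.1 = (-e + (t : ℝ) • (z.1 - -e)) + (1 - (t : ℝ)) • e := by module
          rw [this]
          exact Submodule.add_mem _ (mem_sup_left ht)
            (mem_sup_right (Submodule.smul_mem _ _ (mem_span_singleton_self e)))
      · rintro ⟨h1, h2⟩ hz
        obtain ⟨l, hl, w, hw, hlw⟩ := Submodule.mem_sup.1 hz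
        obtain ⟨r, rfl⟩ := mem_span_singleton.1 hw
        rcases le_total r 0 with hr | hr
        · have hpos : 0 < 1 - r := by linarith
          refine h1 ⟨1 / (1 - r), by positivity, by rw [div_le_one hpos]; linarith⟩ ?_
          have : e + (1 / (1 - r)) • (z.1 - e) = (1 / (1 - r)) • l := by
            rw [← hlw]
            match_scalars <;> field_simp
            ring
          exact this ▸ L.smul_mem _ hl
        · have hpos : 0 < 1 + r := by linarith
          refine h2 ⟨1 / (1 + r), by positivity, by rw [div_le_one hpos]; linarith⟩ ?_
          have : -e + (1 / (1 + r)) • (z.1 - -e) = (1 / (1 + r)) • l := by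
            rw [← hlw]
            match_scalars <;> field_simp
            ring
          exact this ▸ L.smul_mem _ hl
    have hconn := isPathConnected_compl_biUnion (fun _ : Unit => L ⊔ ℝ ∙ e) (fun _ => by
      have := finrank_sup_span_singleton_le L e
      omega)
    exact (hconn.joinedIn x.1 (fun _ => (key x).2 hx) y.1 (fun _ => (key y).2 hy)).subtype
      fun z hz => ⟨fun h => hz () (mem_sup_left h), (key ⟨z, _⟩).1 (hz ())⟩
  · intro x
    by_contra h
    simp only [mem_union, mem_ofPred_eq, not_or, not_forall, not_not] at h
    obtain ⟨⟨t, ht⟩, ⟨s, hs⟩⟩ := h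
    have hcomb : ((s : ℝ) * (1 - t) + t * (1 - s)) • e ∈ L := by
      have : ((s : ℝ) * (1 - t) + t * (1 - s)) • e =
          (s : ℝ) • (e + (t : ℝ) • (x.1 - e)) - (t : ℝ) • (-e + (s : ℝ) • (x.1 - -e)) := by module
      rw [this]
      exact L.sub_mem (L.smul_mem _ ht) (L.smul_mem _ hs)
    have h0 : (s : ℝ) * (1 - t) + t * (1 - s) = 0 := by
      by_contra h0
      exact he ((Submodule.smul_mem_iff _ h0).1 hcomb)
    have hst : (s : ℝ) * (1 - t) = 0 := by
      nlinarith [mul_nonneg s.2.1 (sub_nonneg.2 t.2.2), mul_nonneg t.2.1 (sub_nonneg.2 s.2.2)]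
    rcases mul_eq_zero.1 hst with h | h
    · exact hne (by simpa [h] using hs)
    · have : (t : ℝ) = 1 := by linarith
      exact x.2 (by simpa [this] using ht)

end Complement

/-! ### Winding numbers -/

/-- Every nonvanishing function on a simply connected, locally path connected space has a
continuous logarithm. -/
lemma exists_continuousMap_log {X : Type*} [TopologicalSpace X] [SimplyConnectedSpace X]
    [LocallyPathConnectedSpace X] (f : C(X, ℂ)) (hf : ∀ x, f x ≠ 0) :
    ∃ L : C(X, ℂ), ∀ x, Complex.exp (L x) = f x := by
  obtain ⟨x₀⟩ : Nonempty X := inferInstance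
  obtain ⟨L, ⟨-, hL⟩, -⟩ := Complex.isCoveringMapOn_exp.existsUnique_continuousMap_lifts f
    (a₀ := x₀) (Complex.exp_log (hf x₀)) (fun x => by simpa using hf x)
  exact ⟨L, fun x => congrFun hL x⟩

lemma exists_continuousMap_log_square (f : C(I × I, ℂ)) (hf : ∀ x, f x ≠ 0) :
    ∃ L : C(I × I, ℂ), ∀ x, Complex.exp (L x) = f x := by
  obtain ⟨L, hL⟩ := exists_continuousMap_log (X := ℝ × ℝ) (f.comp
    ⟨fun p => (projIcc 0 1 zero_le_one p.1, projIcc 0 1 zero_le_one p.2),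
      (continuous_projIcc.comp continuous_fst).prodMk (continuous_projIcc.comp continuous_snd)⟩)
    (fun _ => hf _)
  exact ⟨L.comp ⟨fun p => (p.1, p.2), by fun_prop⟩, fun p => by simp [hL]⟩

open Classical in
/-- The integral winding of a nonvanishing path, measured with respect to the principal
logarithms of its endpoints. -/
def wind (γ : C(I, ℂ)) : ℤ :=
  if h : ∃ (n : ℤ) (L : C(I, ℂ)), (∀ t, Complex.exp (L t) = γ t) ∧
    L 1 - L 0 = Complex.log (γ 1) - Complex.log (γ 0) + n * (2 * Real.pi * Complex.I)
  then h.choose else 0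

lemma exp_lift_sub_eq {L M : C(I, ℂ)} (h : ∀ t, Complex.exp (L t) = Complex.exp (M t)) :
    L 1 - L 0 = M 1 - M 0 := by
  have h1 : ∀ t, ∃ n : ℤ, L t - M t = n * (2 * Real.pi * Complex.I) := fun t => by
    obtain ⟨n, hn⟩ := Complex.exp_eq_exp_iff_exists_int.1 (h t)
    exact ⟨n, by rw [hn]; ring⟩
  choose n hn using h1
  have hpi : (2 * Real.pi * Complex.I : ℂ) ≠ 0 := Complex.two_pi_I_ne_zero
  have hcont : Continuous n := by
    have : Continuous fun t => ((n t : ℤ) : ℂ) := by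
      have e : (fun t => ((n t : ℤ) : ℂ)) = fun t => (L t - M t) / (2 * Real.pi * Complex.I) := by
        ext t; rw [hn, mul_div_cancel_right₀ _ hpi]
      rw [e]; fun_prop
    have h2 : Continuous fun t => ((n t : ℤ) : ℝ) := by
      have := Complex.continuous_re.comp this
      simpa [Function.comp_def] using this
    exact Int.isClosedEmbedding_coe_real.isEmbedding.continuous_iff.2 h2
  have := PreconnectedSpace.constant (inferInstance : PreconnectedSpace I) hcont (x := 1) (y := 0)
  have e1 := hn 1
  rw [this, ← hn 0] at e1
  linear_combination e1

lemma wind_spec {γ L : C(I, ℂ)} (hL : ∀ t, Complex.exp (L t) = γ t) :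
    L 1 - L 0 = Complex.log (γ 1) - Complex.log (γ 0) + wind γ * (2 * Real.pi * Complex.I) := by
  have h : ∃ (n : ℤ) (L : C(I, ℂ)), (∀ t, Complex.exp (L t) = γ t) ∧
      L 1 - L 0 = Complex.log (γ 1) - Complex.log (γ 0) + n * (2 * Real.pi * Complex.I) := by
    have h1 : ∀ t, ∃ n : ℤ, L t = Complex.log (γ t) + n * (2 * Real.pi * Complex.I) := fun t => by
      refine Complex.exp_eq_exp_iff_exists_int.1 ?_
      rw [Complex.exp_log (by rw [← hL]; exact Complex.exp_ne_zero _), hL]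
    obtain ⟨n, hn⟩ := h1 1
    obtain ⟨m, hm⟩ := h1 0
    exact ⟨n - m, L, hL, by rw [hn, hm]; push_cast; ring⟩
  rw [wind, dif_pos h]
  obtain ⟨M, hM, hM'⟩ := h.choose_spec
  rw [exp_lift_sub_eq fun t => (hL t).trans (hM t).symm, hM']

lemma wind_eq_of_lift {γ L : C(I, ℂ)} (hL : ∀ t, Complex.exp (L t) = γ t) {n : ℤ}
    (hn : L 1 - L 0 = Complex.log (γ 1) - Complex.log (γ 0) + n * (2 * Real.pi * Complex.I)) :
    wind γ = n := by
  have := wind_spec hL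
  rw [hn, add_right_inj, mul_left_inj' Complex.two_pi_I_ne_zero] at this
  exact_mod_cast this.symm

lemma isCocycle_wind {X : Type*} [TopologicalSpace X] (f : C(X, ℂ)) (hf : ∀ x, f x ≠ 0) :
    IsCocycle fun γ : C(I, X) => wind (f.comp γ) where
  const x := wind_eq_of_lift (γ := f.comp (.const I x)) (L := .const I (Complex.log (f x)))
    (fun t => Complex.exp_log (hf x)) (by simp)
  square H := by
    obtain ⟨L, hL⟩ := exists_continuousMap_log_square (f.comp H) (fun _ => hf _)
    have hb := wind_spec (γ := f.comp (H.comp edgeBottom)) (L := L.comp edgeBottom)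
      (fun t => hL _)
    have hr := wind_spec (γ := f.comp (H.comp edgeRight)) (L := L.comp edgeRight)
      (fun t => hL _)
    have hl := wind_spec (γ := f.comp (H.comp edgeLeft)) (L := L.comp edgeLeft)
      (fun t => hL _)
    have ht := wind_spec (γ := f.comp (H.comp edgeTop)) (L := L.comp edgeTop)
      (fun t => hL _)
    simp only [ContinuousMap.comp_apply, edgeBottom, edgeTop, edgeLeft, edgeRight,
      ContinuousMap.coe_mk] at hb hr hl ht
    have key := congrArg₂ (· - ·) (congrArg₂ (· + ·) hb hr) (congrArg₂ (· + ·) hl ht)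
    have : ((wind (f.comp (H.comp edgeBottom)) + wind (f.comp (H.comp edgeRight)) : ℤ) : ℂ) =
        ((wind (f.comp (H.comp edgeLeft)) + wind (f.comp (H.comp edgeTop)) : ℤ) : ℂ) := by
      apply mul_right_cancel₀ Complex.two_pi_I_ne_zero
      push_cast
      simp only [edgeBottom, edgeTop, edgeLeft, edgeRight]
      linear_combination -key
    exact_mod_cast this

lemma wind_eq_zero_of_div_mem_slitPlane {γ : C(I, ℂ)} (h : γ 0 = γ 1) {d : ℂ} (hd : d ≠ 0)
    (hγ : ∀ t, γ t / d ∈ Complex.slitPlane) : wind γ = 0 := by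
  refine wind_eq_of_lift (L := ⟨fun t => Complex.log d + Complex.log (γ t / d),
    continuous_const.add (Continuous.clog (by fun_prop) hγ)⟩) (fun t => ?_) ?_
  · simp [Complex.exp_add, Complex.exp_log hd,
      Complex.exp_log (Complex.slitPlane_ne_zero (hγ t)), mul_div_cancel₀ _ hd]
  · simp [h]

/-- The circle loop. -/
def circlePath (z r : ℂ) : C(I, ℂ) :=
  ⟨fun t => z + r * Complex.exp (2 * Real.pi * Complex.I * (t : ℝ)), by fun_prop⟩

lemma circlePath_zero (z r : ℂ) : circlePath z r 0 = z + r := by simp [circlePath]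

lemma circlePath_one (z r : ℂ) : circlePath z r 1 = z + r := by
  simp [circlePath, Complex.exp_two_pi_mul_I]

lemma norm_circlePath_sub (z r : ℂ) (t : I) : ‖circlePath z r t - z‖ = ‖r‖ := by
  have : (2 * Real.pi * Complex.I * ((t : ℝ) : ℂ)) = ((2 * Real.pi * t : ℝ) : ℂ) * Complex.I := by
    push_cast; ring
  simp only [circlePath, ContinuousMap.coe_mk, add_sub_cancel_left, norm_mul]
  rw [this, Complex.norm_exp_ofReal_mul_I, mul_one]

lemma wind_circlePath {r : ℂ} (hr : r ≠ 0) : wind (circlePath 0 r) = 1 := by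
  refine wind_eq_of_lift
    (L := ⟨fun t => Complex.log r + 2 * Real.pi * Complex.I * (t : ℝ), by fun_prop⟩)
    (fun t => ?_) ?_
  · simp [circlePath, Complex.exp_add, Complex.exp_log hr]
  · simp [circlePath_one, circlePath_zero]

lemma wind_circlePath_eq_zero {z r : ℂ} (h : ‖r‖ < ‖z‖) : wind (circlePath z r) = 0 := by
  have hz : z ≠ 0 := norm_pos_iff.1 ((norm_nonneg r).trans_lt h)
  refine wind_eq_zero_of_div_mem_slitPlane (by rw [circlePath_zero, circlePath_one]) hz
    fun t => Or.inl ?_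
  have h1 : ‖(circlePath z r t - z) / z‖ < 1 := by
    rw [norm_div, norm_circlePath_sub, div_lt_one (norm_pos_iff.2 hz)]; exact h
  have h2 := (abs_lt.1 ((Complex.abs_re_le_norm _).trans_lt h1)).1
  rw [sub_div, div_self hz, Complex.sub_re, Complex.one_re] at h2
  linarith

/-! ### The plane minus finitely many points -/

section Plane

variable {A : Type*} [AddCommGroup A]

/-- The circle of radius `r` around `s` as a path in an open set. -/
def circleIn (O : Set ℂ) (s r : ℂ) (h : ∀ t, circlePath s r t ∈ O) : C(I, O) :=
  ⟨fun t => ⟨circlePath s r t, h t⟩, by fun_prop⟩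

/-- A cocycle on the punctured plane which vanishes on the unit circle is exact. -/
lemma IsCocycle.isExact_punctured {c : C(I, {z : ℂ | z ≠ 0}) → A} (hc : IsCocycle c)
    (h : ∀ t, circlePath 0 1 t ∈ {z : ℂ | z ≠ 0})
    (h1 : c (circleIn _ 0 1 h) = 0) : IsExact c := by
  let q : C(ℂ, {z : ℂ | z ≠ 0}) := ⟨fun z => ⟨Complex.exp z, Complex.exp_ne_zero z⟩, by fun_prop⟩
  obtain ⟨g, hg⟩ : IsExact fun γ : C(I, ℂ) => c (q.comp γ) :=
    (hc.pullback q).isExact_of_homotopy (ContinuousMap.const ℂ 0) (ContinuousMap.id ℂ)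
      ⟨fun p => (p.2 : ℝ) * p.1, by fun_prop⟩ (by simp) (by simp)
      ⟨0, fun γ => by simpa using hc.const (q 0)⟩
  replace hg : ∀ γ, c (q.comp γ) = g (γ 1) - g (γ 0) := hg
  have hper : ∀ z, g (z + 2 * Real.pi * Complex.I) = g z := by
    have h0 : g (2 * Real.pi * Complex.I) = g 0 := by
      have := hg ⟨fun t => 2 * Real.pi * Complex.I * (t : ℝ), by fun_prop⟩
      rw [show q.comp ⟨fun t : I => 2 * Real.pi * Complex.I * (t : ℝ), by fun_prop⟩ =
        circleIn _ 0 1 h by ext t; simp [q, circleIn, circlePath]] at this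
      rw [h1] at this
      simpa [sub_eq_zero] using this.symm
    intro z
    have e1 := hg ⟨fun t => z * (t : ℝ), by fun_prop⟩
    have e2 := hg ⟨fun t => z * (t : ℝ) + 2 * Real.pi * Complex.I, by fun_prop⟩
    rw [show q.comp ⟨fun t : I => z * (t : ℝ) + 2 * Real.pi * Complex.I, by fun_prop⟩ =
      q.comp ⟨fun t : I => z * (t : ℝ), by fun_prop⟩ by
        ext t; simp [q, Complex.exp_add, Complex.exp_two_pi_mul_I], e1] at e2
    simp only [ContinuousMap.coe_mk, Icc.coe_one, Icc.coe_zero, Complex.ofReal_one, mul_one,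
      Complex.ofReal_zero, mul_zero, zero_add, h0] at e2
    exact (sub_left_inj.1 e2).symm
  have hperZ : ∀ (n : ℤ) z, g (z + n * (2 * Real.pi * Complex.I)) = g z := by
    intro n
    induction n with
    | zero => simp
    | succ n ih =>
      intro z
      refine Eq.trans ?_ ((hper _).trans (ih z))
      push_cast; congr 1; ring
    | pred n ih =>
      intro z
      refine Eq.trans ((hper _).symm.trans ?_) (ih z)
      push_cast; congr 1; ring
  refine hc.isExact_of_local_sections q (fun z => ⟨Complex.log z.1, Subtype.ext
    (Complex.exp_log z.2)⟩) g hg (fun y y' hyy => ?_) (fun x => ?_)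
  · obtain ⟨n, hn⟩ := Complex.exp_eq_exp_iff_exists_int.1 (congrArg Subtype.val hyy)
    rw [hn, hperZ]
  · have hx : x.1 ≠ 0 := x.2
    refine ⟨{y | y.1 / x.1 ∈ Complex.slitPlane}, ?_,
      ⟨fun y => Complex.log x.1 + Complex.log (y.1.1 / x.1),
        continuous_const.add (Continuous.clog (by fun_prop) fun y => y.2)⟩, fun y => ?_⟩
    · refine (Complex.isOpen_slitPlane.preimage (f := fun y : {z : ℂ | z ≠ 0} => y.1 / x.1)
        (by fun_prop)).mem_nhds ?_
      simp [div_self hx]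
    · ext1
      have hy : y.1.1 ≠ 0 := y.1.2
      simp [q, Complex.exp_add, Complex.exp_log hx, Complex.exp_log (div_ne_zero hy hx),
        mul_div_cancel₀ _ hx]

end Plane

section Plane

variable {A : Type*} [AddCommGroup A]

lemma exactOn_of_isExact_inclusion {X : Type*} [TopologicalSpace X] {O U : Set X}
    {c : C(I, O) → A} (hUO : U ⊆ O)
    (h : IsExact fun γ : C(I, U) => c ((ContinuousMap.inclusion hUO).comp γ)) :
    ExactOn c {z : O | z.1 ∈ U} := by
  classical
  obtain ⟨g, hg⟩ := h
  refine ⟨fun z => if hz : z.1 ∈ U then g ⟨z.1, hz⟩ else 0, fun γ hγ => ?_⟩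
  have := hg ⟨fun t => ⟨(γ t).1, hγ t⟩, by fun_prop⟩
  simp only [show ∀ t, (γ t).1 ∈ U from hγ, dif_pos]
  exact this

/-- A cocycle on the complement of a finite set is exact near a puncture if it vanishes on a
small circle. -/
lemma IsCocycle.exactOn_convex_of_inter_eq_singleton {S : Set ℂ} {c : C(I, (Sᶜ : Set ℂ)) → A}
    (hc : IsCocycle c) {U : Set ℂ} (hU : Convex ℝ U) {s : ℂ} (hs : S ∩ U = {s}) {ε : ℝ}
    (hε : 0 < ε) (hball : ∀ s' ∈ S, s' ≠ s → ε < ‖s' - s‖)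
    (h : ∀ t, circlePath s ε t ∈ Sᶜ) (h0 : c (circleIn Sᶜ s ε h) = 0) :
    ExactOn c {z | z.1 ∈ U} := by
  have hsU : s ∈ U := (hs.symm.subset rfl).2
  have hnear : ∀ z, z ≠ s → ‖z - s‖ ≤ ε → z ∈ Sᶜ := fun z hz hze hzS =>
    (hball z hzS hz).not_ge hze
  have hfar : ∀ z ∈ U, z ≠ s → z ∈ Sᶜ := fun z hz hzs hzS => hzs (hs.subset ⟨hzS, hz⟩)
  let Z : Set ℂ := {z | z ∈ U ∧ z ≠ s}
  have hZ : Z ⊆ Sᶜ := fun z hz => hfar z hz.1 hz.2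
  have hn : ∀ ζ : {z : ℂ | z ≠ 0}, ‖ζ.1‖ ≠ 0 := fun ζ => norm_ne_zero_iff.2 ζ.2
  let m : C({z : ℂ | z ≠ 0}, (Sᶜ : Set ℂ)) := ⟨fun ζ => ⟨s + (ε / ‖ζ.1‖ : ℝ) • ζ.1, by
      have hp : 0 < ‖ζ.1‖ := norm_pos_iff.2 ζ.2
      refine hnear _ ?_ ?_
      · simpa [hε.ne'] using show ζ.1 ≠ 0 from ζ.2
      · rw [add_sub_cancel_left, norm_smul, Real.norm_of_nonneg (by positivity),
          div_mul_cancel₀ _ hp.ne']⟩,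
    by fun_prop (disch := exact hn)⟩
  let d : C(Z, {z : ℂ | z ≠ 0}) := ⟨fun z => ⟨z.1 - s, sub_ne_zero.2 z.2.2⟩, by fun_prop⟩
  have hm : IsExact fun γ => c (m.comp γ) := by
    refine (hc.pullback m).isExact_punctured (fun t ht => ?_) ?_
    · have := norm_circlePath_sub 0 1 t
      simp [ht] at this
    · refine Eq.trans (congrArg c (ContinuousMap.ext fun t => Subtype.ext ?_)) h0
      have := norm_circlePath_sub 0 1 t
      simp only [sub_zero, norm_one] at this
      simp [m, circleIn, this]
      simp [circlePath]
  obtain ⟨g, hg⟩ := hm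
  have hexact : IsExact fun γ : C(I, Z) => c ((ContinuousMap.inclusion hZ).comp γ) := by
    have hnz : ∀ x : Z × I, ‖x.1.1 - s‖ ≠ 0 := fun x => norm_ne_zero_iff.2 (sub_ne_zero.2 x.1.2.2)
    have hmem : ∀ x : Z × I,
        s + ((1 - (x.2 : ℝ)) * (ε / ‖x.1.1 - s‖) + x.2 : ℝ) • (x.1.1 - s) ∈ Sᶜ := by
      rintro ⟨⟨z, hzU, hzs⟩, t⟩
      have hp : 0 < ‖z - s‖ := norm_pos_iff.2 (sub_ne_zero.2 hzs)
      have ht0 := t.2.1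
      have ht1 := t.2.2
      set ρ : ℝ := (1 - (t : ℝ)) * (ε / ‖z - s‖) + t with hρ
      have hq : 0 < ε / ‖z - s‖ := by positivity
      have hρ0 : 0 < ρ := by
        rcases ht0.eq_or_lt with h | h
        · rw [hρ, ← h]; simpa using hq
        · have := mul_nonneg (sub_nonneg.2 ht1) hq.le
          linarith
      have hne : s + ρ • (z - s) ≠ s := by simpa [hρ0.ne', sub_eq_zero] using hzs
      rcases le_total (ε / ‖z - s‖) 1 with h | h
      · refine hfar _ ?_ hne
        have hρ1 : ρ ≤ 1 := by nlinarith
        exact hU.add_smul_sub_mem hsU hzU ⟨hρ0.le, hρ1⟩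
      · refine hnear _ hne ?_
        rw [add_sub_cancel_left, norm_smul, Real.norm_of_nonneg hρ0.le]
        have : ρ ≤ ε / ‖z - s‖ := by nlinarith
        calc ρ * ‖z - s‖ ≤ ε / ‖z - s‖ * ‖z - s‖ := by gcongr
          _ = ε := div_mul_cancel₀ _ hp.ne'
    refine hc.isExact_of_homotopy (m.comp d) (ContinuousMap.inclusion hZ)
      ⟨fun x => ⟨_, hmem x⟩, by fun_prop (disch := assumption)⟩ (fun z => ?_) (fun z => ?_)
      ⟨fun z => g (d z), fun γ => hg (d.comp γ)⟩
    · ext1; simp [m, d]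
    · ext1; simp [ContinuousMap.inclusion]
  obtain ⟨g', hg'⟩ := exactOn_of_isExact_inclusion hZ hexact
  exact ⟨g', fun γ hγ => hg' γ fun t => ⟨hγ t, fun e => (γ t).2 (e ▸ (hs.symm.subset rfl).1)⟩⟩

/-- A cocycle on the plane minus a finite set is exact if it vanishes on small circles around
the punctures. -/
lemma IsCocycle.isExact_compl_finite {S : Set ℂ} (hS : S.Finite) {c : C(I, (Sᶜ : Set ℂ)) → A}
    (hc : IsCocycle c) {ε : ℂ → ℝ} (hε : ∀ s ∈ S, 0 < ε s)
    (hball : ∀ s ∈ S, ∀ s' ∈ S, s' ≠ s → ε s < ‖s' - s‖)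
    (h : ∀ s ∈ S, ∀ t, circlePath s (ε s) t ∈ Sᶜ)
    (h0 : ∀ s (hs : s ∈ S), c (circleIn Sᶜ s (ε s) (h s hs)) = 0) : IsExact c := by
  suffices H : ∀ m, ∀ U : Set ℂ, IsOpen U → Convex ℝ U → (S ∩ U).ncard = m →
      ExactOn c {z | z.1 ∈ U} from
    (H _ univ isOpen_univ convex_univ rfl).isExact fun _ => mem_univ _
  intro m
  induction m using Nat.strong_induction_on with
  | _ m ih =>
  intro U hUo hU hm
  have hfin : (S ∩ U).Finite := hS.subset inter_subset_left
  rcases (S ∩ U).eq_empty_or_nonempty with hem | ⟨s, hs⟩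
  · rcases U.eq_empty_or_nonempty with rfl | ⟨p, hp⟩
    · exact ⟨0, fun γ hγ => (hγ 0).elim⟩
    have hUS : U ⊆ Sᶜ := fun z hz hzS => hem.subset ⟨hzS, hz⟩
    exact exactOn_of_isExact_inclusion hUS
      ((hc.pullback (ContinuousMap.inclusion hUS)).isExact_of_starConvex hp (hU.starConvex hp))
  by_cases hsing : S ∩ U = {s}
  · exact hc.exactOn_convex_of_inter_eq_singleton hU hsing (hε s hs.1) (hball s hs.1) (h s hs.1)
      (h0 s hs.1)
  obtain ⟨s', hs', hne⟩ : ∃ s' ∈ S ∩ U, s' ≠ s := by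
    by_contra! hcon
    exact hsing (eq_singleton_iff_unique_mem.2 ⟨hs, hcon⟩)
  obtain ⟨ℓ, hℓ⟩ : ∃ ℓ : ℂ →L[ℝ] ℝ, ℓ s < ℓ s' := by
    by_cases hre : s.re = s'.re
    · have him : s.im ≠ s'.im := fun h => hne (Complex.ext hre.symm h.symm)
      rcases him.lt_or_gt with h | h
      · exact ⟨Complex.imCLM, h⟩
      · exact ⟨-Complex.imCLM, by simpa using h⟩
    · rcases lt_or_gt_of_ne hre with h | h
      · exact ⟨Complex.reCLM, h⟩
      · exact ⟨-Complex.reCLM, by simpa using h⟩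
  obtain ⟨b, ⟨hbS, hb⟩, hbmin⟩ := ((hfin.subset (sep_subset _ (fun z =>
    ℓ s < ℓ z))).exists_minimalFor
    ℓ _ ⟨s', hs', hℓ⟩)
  have hgap : ∀ z ∈ S ∩ U, ℓ s < ℓ z → ℓ z < ℓ b → False := fun z hz h1 h2 =>
    (hbmin ⟨hz, h1⟩ h2.le).not_gt h2
  have hopen1 : IsOpen (U ∩ {z | ℓ z < ℓ b}) := hUo.inter (isOpen_lt ℓ.continuous continuous_const)
  have hopen2 : IsOpen (U ∩ {z | ℓ s < ℓ z}) := hUo.inter (isOpen_lt continuous_const ℓ.continuous)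
  have hconv1 : Convex ℝ (U ∩ {z | ℓ z < ℓ b}) :=
    hU.inter (convex_halfSpace_lt ℓ.toLinearMap.isLinear _)
  have hconv2 : Convex ℝ (U ∩ {z | ℓ s < ℓ z}) :=
    hU.inter (convex_halfSpace_gt ℓ.toLinearMap.isLinear _)
  have e1 := ih _ (hm ▸ ncard_lt_ncard ⟨inter_subset_inter_right S inter_subset_left,
    fun hsub => lt_irrefl (ℓ b) (hsub hbS).2.2⟩ hfin) _ hopen1 hconv1 rfl
  have e2 := ih _ (hm ▸ ncard_lt_ncard ⟨inter_subset_inter_right S inter_subset_left,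
    fun hsub => lt_irrefl (ℓ s) (hsub hs).2.2⟩ hfin) _ hopen2 hconv2 rfl
  have := hc.exactOn_union (hopen1.preimage continuous_subtype_val)
    (hopen2.preimage continuous_subtype_val) e1 e2 ?_
  · obtain ⟨g, hg⟩ := this
    refine ⟨g, fun γ hγ => hg γ fun t => ?_⟩
    rcases lt_or_ge (ℓ (γ t).1) (ℓ b) with h | h
    · exact Or.inl ⟨hγ t, h⟩
    · exact Or.inr ⟨hγ t, lt_of_lt_of_le hb h⟩
  · rintro ⟨x, hxS⟩ hx ⟨y, hyS⟩ hy
    have hsegm : ∀ t : I, AffineMap.lineMap (k := ℝ) x y (t : ℝ) ∈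
        (U ∩ {z | ℓ z < ℓ b}) ∩ (U ∩ {z | ℓ s < ℓ z}) := fun t =>
      (hconv1.inter hconv2).lineMap_mem hx hy t.2
    refine ⟨⟨⟨fun t => ⟨AffineMap.lineMap (k := ℝ) x y (t : ℝ), fun hS => ?_⟩, ?_⟩, ?_, ?_⟩,
      fun t => hsegm t⟩
    · exact hgap _ ⟨hS, (hsegm t).1.1⟩ (hsegm t).2.2 (hsegm t).1.2
    · exact (Continuous.comp (by fun_prop) continuous_subtype_val).subtype_mk _
    · ext1; simp
    · ext1; simp

end Plane

/-! ### Configurations in the plane, normalized by `w 0 = 0` and `w 1 = 1` -/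

/-- Configurations of distinct complex numbers whose first two members are `0` and `1`. -/
def Conf (r : ℕ) : Set (Fin (r + 2) → ℂ) := {w | Function.Injective w ∧ w 0 = 0 ∧ w 1 = 1}

namespace Conf

variable {r : ℕ}

@[fun_prop]
lemma continuous_coord {Z : Type*} [TopologicalSpace Z] {f : Z → Conf r} (hf : Continuous f)
    (i : Fin (r + 2)) : Continuous fun z => (f z).1 i :=
  (continuous_apply i).comp (continuous_subtype_val.comp hf)

/-- The difference of two members of a configuration. -/
def diff (i j : Fin (r + 2)) : C(Conf r, ℂ) := ⟨fun w => w.1 j - w.1 i, by fun_prop⟩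

lemma diff_ne_zero {i j : Fin (r + 2)} (h : i < j) (w : Conf r) : diff i j w ≠ 0 :=
  sub_ne_zero.2 fun e => h.ne' (w.2.1 e)

/-- The standard configuration. -/
def base (r : ℕ) : Conf r := ⟨fun i => (i : ℕ), fun i j h => Fin.ext (Nat.cast_injective h),
  by simp, by simp⟩

/-- The universal punctured plane over the configuration space. -/
def Total (r : ℕ) : Set (Conf r × ℂ) := {e | ∀ i, e.2 ≠ e.1.1 i}

lemma isOpen_total : IsOpen (Total r) := by
  simp only [Total, ofPred_forall]
  exact isOpen_iInter_of_finite fun i => isOpen_ne_fun (by fun_prop) (by fun_prop)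

/-- Adjoin a point to a configuration. -/
def adjoin : C(Total r, Conf (r + 1)) :=
  ⟨fun e => ⟨Fin.snoc (α := fun _ => ℂ) e.1.1.1 e.1.2, by
    refine ⟨Fin.snoc_injective_iff.2 ⟨e.1.1.2.1, ?_⟩, ?_, ?_⟩
    · rintro ⟨i, hi⟩; exact e.2 i hi.symm
    · rw [← Fin.castSucc_zero, Fin.snoc_castSucc]; exact e.1.1.2.2.1
    · rw [← Fin.castSucc_one, Fin.snoc_castSucc]; exact e.1.1.2.2.2⟩, by
    refine Continuous.subtype_mk (continuous_pi fun i => ?_) _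
    refine Fin.lastCases ?_ (fun i => ?_) i
    · simp only [Fin.snoc_last]; fun_prop
    · simp only [Fin.snoc_castSucc]; fun_prop⟩

@[simp] lemma adjoin_castSucc (e : Total r) (i : Fin (r + 2)) :
    (adjoin e).1 i.castSucc = e.1.1.1 i :=
  Fin.snoc_castSucc (α := fun _ => ℂ) _ _ _

@[simp] lemma adjoin_last (e : Total r) : (adjoin e).1 (Fin.last _) = e.1.2 :=
  Fin.snoc_last (α := fun _ => ℂ) _ _

/-- Split off the last point of a configuration. -/
def split : C(Conf (r + 1), Total r) :=
  ⟨fun w => ⟨(⟨fun i => w.1 i.castSucc, fun _ _ h => Fin.castSucc_injective _ (w.2.1 h),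
    w.2.2.1, w.2.2.2⟩, w.1 (Fin.last _)), fun i h => (Fin.castSucc_lt_last i).ne' (w.2.1 h)⟩,
    by fun_prop⟩

lemma adjoin_split (w : Conf (r + 1)) : adjoin (split w) = w :=
  Subtype.ext (funext fun i => by
    refine Fin.lastCases ?_ (fun i => ?_) i
    · rw [adjoin_last]; rfl
    · rw [adjoin_castSucc]; rfl)

/-- A point to the right of all members of a configuration. -/
def sec : C(Conf r, Total r) :=
  ⟨fun w => ⟨(w, (1 + ∑ i, ‖w.1 i‖ : ℝ)), fun i h => by
    have h1 := congrArg norm (show ((1 + ∑ i, ‖w.1 i‖ : ℝ) : ℂ) = w.1 i from h)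
    have h2 := Finset.single_le_sum (f := fun i => ‖w.1 i‖) (fun i _ => norm_nonneg _)
      (Finset.mem_univ i)
    rw [Complex.norm_of_nonneg (by positivity)] at h1
    linarith⟩, by fun_prop⟩

lemma re_sec_sub_pos (w : Conf r) (i : Fin (r + 2)) : 0 < ((sec w).1.2 - w.1 i).re := by
  have h2 := Finset.single_le_sum (f := fun i => ‖w.1 i‖) (fun i _ => norm_nonneg _)
    (Finset.mem_univ i)
  have h3 := (Complex.re_le_norm (w.1 i))
  simp only [sec, ContinuousMap.coe_mk, Complex.sub_re, Complex.ofReal_re]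
  linarith

/-- A radius smaller than the distance of `s` to the other members of a configuration. -/
def radius (w : Conf r) (s : ℂ) : ℝ := (1 + ∑ j, ‖w.1 j - s‖⁻¹)⁻¹

lemma radius_pos (w : Conf r) (s : ℂ) : 0 < radius w s := by
  unfold radius; positivity

lemma radius_lt (w : Conf r) {s : ℂ} {j : Fin (r + 2)} (h : w.1 j ≠ s) :
    radius w s < ‖w.1 j - s‖ := by
  have hp : 0 < ‖w.1 j - s‖ := norm_pos_iff.2 (sub_ne_zero.2 h)
  have := Finset.single_le_sum (f := fun j => ‖w.1 j - s‖⁻¹) (fun i _ => by positivity)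
    (Finset.mem_univ j)
  exact inv_lt_of_inv_lt₀ hp (by linarith)

lemma continuous_radius (i : Fin (r + 2)) : Continuous fun w : Conf r => radius w (w.1 i) := by
  refine Continuous.inv₀ (continuous_const.add (continuous_finsetSum _ fun j _ => ?_))
    fun w => by positivity
  by_cases hij : j = i
  · simp only [hij, sub_self, norm_zero]; exact continuous_const
  · exact Continuous.inv₀ (by fun_prop) fun w =>
      norm_ne_zero_iff.2 (sub_ne_zero.2 fun h => hij (w.2.1 h))

lemma circlePath_ne (w : Conf r) (i j : Fin (r + 2)) (t : I) :
    circlePath (w.1 i) (radius w (w.1 i)) t ≠ w.1 j := by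
  intro h
  have h1 := norm_circlePath_sub (w.1 i) (radius w (w.1 i)) t
  rw [h, Complex.norm_of_nonneg (radius_pos _ _).le] at h1
  by_cases hij : w.1 j = w.1 i
  · rw [hij, sub_self, norm_zero] at h1
    exact (radius_pos w (w.1 i)).ne h1
  · exact (radius_lt w hij).ne' h1

/-- The loop in which an additional point turns around a member of a configuration. -/
def meridian (i : Fin (r + 2)) : C(Conf r × I, Total r) :=
  ⟨fun x => ⟨(x.1, circlePath (x.1.1 i) (radius x.1 (x.1.1 i)) x.2),
    fun j => circlePath_ne x.1 i j x.2⟩, by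
    have := (continuous_radius i).comp (continuous_fst (X := Conf r) (Y := I))
    simp only [circlePath, ContinuousMap.coe_mk]
    simp only [Function.comp_def] at this
    fun_prop⟩

/-- The meridian loop over a fixed configuration. -/
def meridianAt (w : Conf r) (i : Fin (r + 2)) : C(I, Total r) :=
  ⟨fun t => meridian i (w, t), by fun_prop⟩

lemma isPathConnected_fibre (w : Conf r) : IsPathConnected {z | (w, z) ∈ Total r} := by
  have h : {z | (w, z) ∈ Total r} = (range w.1)ᶜ := by
    ext z; simp [Total, eq_comm]
  rw [h]
  exact (finite_range _).countable.isPathConnected_compl_of_one_lt_rank (by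
    rw [Complex.rank_real_complex]; norm_num)

lemma joinedIn_fibre (w : Conf r) : ∀ z ∈ {z | (w, z) ∈ Total r}, ∀ z' ∈ {z | (w, z) ∈ Total r},
    JoinedIn {z | (w, z) ∈ Total r} z z' := fun _ hz _ hz' =>
  (isPathConnected_fibre w).joinedIn _ hz _ hz'

lemma joined_sec (e : Total r) : Joined e (sec e.1.1) := by
  obtain ⟨p, hp⟩ := joinedIn_fibre e.1.1 e.1.2 e.2 (sec e.1.1).1.2 (sec e.1.1).2
  exact ⟨⟨⟨fun t => ⟨(e.1.1, p t), hp t⟩, by fun_prop⟩, by ext <;> simp, by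
    refine Subtype.ext (Prod.ext rfl ?_); simp⟩⟩

instance pathConnectedSpace (r : ℕ) : PathConnectedSpace (Conf r) := by
  induction r with
  | zero =>
    refine ⟨⟨base 0⟩, fun w w' => ?_⟩
    have : w = w' := Subtype.ext (funext fun i => by
      fin_cases i
      · exact w.2.2.1.trans w'.2.2.1.symm
      · exact w.2.2.2.trans w'.2.2.2.symm)
    exact this ▸ Joined.refl w
  | succ r ih =>
    refine ⟨⟨base _⟩, fun w w' => ?_⟩
    have h : Joined (split w) (split w') := (joined_sec _).trans
      (((PathConnectedSpace.joined (split w).1.1 (split w').1.1).map sec.continuous).trans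
        (joined_sec _).symm)
    simpa only [adjoin_split] using h.map adjoin.continuous

variable {A : Type*} [AddCommGroup A]

lemma _root_.IsCocycle.meridianAt_eq {c : C(I, Total r) → A} (hc : IsCocycle c)
    (i : Fin (r + 2)) (w w' : Conf r) : c (meridianAt w i) = c (meridianAt w' i) := by
  obtain ⟨p⟩ := PathConnectedSpace.joined w w'
  have h := hc.square ((meridian i).comp ⟨fun x : I × I => (p x.1, x.2), by fun_prop⟩)
  have e : ((meridian i).comp ⟨fun x : I × I => (p x.1, x.2), by fun_prop⟩).comp edgeBottom =
      ((meridian i).comp ⟨fun x : I × I => (p x.1, x.2), by fun_prop⟩).comp edgeTop := by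
    ext1 s
    refine Subtype.ext (Prod.ext rfl ?_)
    exact (circlePath_zero _ _).trans (circlePath_one _ _).symm
  rw [e, add_comm] at h
  refine Eq.trans (congrArg c ?_) ((add_right_cancel h).symm.trans (congrArg c ?_)) <;>
  · ext1 t
    simp [meridianAt, edgeLeft, edgeRight]

/-- A cocycle on the universal punctured plane which vanishes on the meridians is determined by
its restriction to the section. -/
lemma _root_.IsCocycle.isExact_total {c : C(I, Total r) → A} (hc : IsCocycle c) (w₀ : Conf r)
    (hmer : ∀ i, c (meridianAt w₀ i) = 0)
    (hsec : IsExact fun γ : C(I, Conf r) => c (sec.comp γ)) : IsExact c := by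
  obtain ⟨g, hg⟩ := hc.exists_eq_section_add isOpen_total sec (fun _ => rfl) joinedIn_fibre
    fun w => by
      have hmem : ∀ z : ((range w.1)ᶜ : Set ℂ), (w, z.1) ∈ Total r := fun z i hi =>
        z.2 ⟨i, hi.symm⟩
      have hmem' : ∀ z : {z // (w, z) ∈ Total r}, z.1 ∈ ((range w.1)ᶜ : Set ℂ) := by
        rintro z ⟨i, hi⟩
        exact z.2 i hi.symm
      have hcircle : ∀ s ∈ range w.1, ∀ t, circlePath s (radius w s) t ∈ (range w.1)ᶜ := by
        rintro _ ⟨i, rfl⟩ t ⟨j, hj⟩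
        exact circlePath_ne w i j t hj.symm
      obtain ⟨g, hg⟩ := (hc.pullback ⟨fun z : ((range w.1)ᶜ : Set ℂ) => ⟨(w, z.1), hmem z⟩,
        by fun_prop⟩).isExact_compl_finite (finite_range w.1) (ε := radius w)
        (fun s _ => radius_pos w s) (by rintro s - _ ⟨j, rfl⟩ hj; exact radius_lt w hj) hcircle
        (by
          rintro _ ⟨i, rfl⟩
          exact (hc.meridianAt_eq i w w₀).trans (hmer i))
      exact ⟨fun z => g ⟨z.1, hmem' z⟩, fun γ => hg ⟨fun t => ⟨(γ t).1, hmem' (γ t)⟩,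
        by fun_prop⟩⟩
  obtain ⟨h, hh⟩ := hsec
  refine ⟨fun e => h e.1.1 + g e, fun γ => (hg γ).trans ?_⟩
  rw [show c (sec.comp _) = _ from hh _]
  simp only [ContinuousMap.coe_mk]
  abel

lemma wind_const {z : ℂ} (hz : z ≠ 0) : wind (.const I z) = 0 :=
  wind_eq_zero_of_div_mem_slitPlane rfl hz fun _ => by simp [div_self hz]

/-- The configuration space has loops dual to the winding numbers of its members around each
other, and a cocycle which vanishes on these loops is exact. -/
theorem exists_dual_loops (r : ℕ) : ∃ l : Fin (r + 2) → Fin (r + 2) → C(I, Conf r),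
    (∀ i j, l i j 0 = l i j 1) ∧
    (∀ i j, i < j → 1 < j → ∀ i' j', i' < j' → 1 < j' →
      wind ((diff i' j').comp (l i j)) = if i = i' ∧ j = j' then 1 else 0) ∧
    ∀ (A : Type) [AddCommGroup A] (c : C(I, Conf r) → A), IsCocycle c →
      (∀ i j, i < j → 1 < j → c (l i j) = 0) → IsExact c := by
  induction r with
  | zero =>
    refine ⟨fun _ _ => .const I (base 0), fun _ _ => rfl, fun i j _ hj => ?_, fun A _ c hc _ => ?_⟩
    · exact absurd hj (not_lt.2 (Fin.le_last j))
    · refine ⟨0, fun γ => ?_⟩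
      have : γ = .const I (γ 0) := ContinuousMap.ext fun t => Subtype.ext (funext fun i => by
        fin_cases i
        · exact (γ t).2.2.1.trans (γ 0).2.2.1.symm
        · exact (γ t).2.2.2.trans (γ 0).2.2.2.symm)
      rw [this, hc.const]; simp
  | succ r ih =>
    obtain ⟨l, hl, hdual, hex⟩ := ih
    let L : Fin (r + 3) → Fin (r + 3) → C(I, Total r) := fun i j =>
      Fin.lastCases (motive := fun _ => C(I, Total r)) (sec.comp (l 0 0)) (fun i =>
        Fin.lastCases (motive := fun _ => C(I, Total r)) (meridianAt (base r) i)
          (fun j => sec.comp (l i j)) j) i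
    have hL1 : ∀ i j, L (Fin.castSucc i) (Fin.castSucc j) = sec.comp (l i j) := fun i j => by
      simp [L]
    have hL2 : ∀ i, L (Fin.castSucc i) (Fin.last _) = meridianAt (base r) i := fun i => by
      simp [L]
    have hloop : ∀ i j, L i j 0 = L i j 1 := by
      intro i j
      induction i using Fin.lastCases with
      | last => simp [L, hl]
      | cast i =>
        induction j using Fin.lastCases with
        | last =>
          rw [hL2]
          exact Subtype.ext (Prod.ext rfl ((circlePath_zero _ _).trans (circlePath_one _ _).symm))
        | cast j => simp [hL1, hl]
    refine ⟨fun i j => adjoin.comp (L i j), fun i j => congrArg adjoin (hloop i j),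
      fun i j hij hj i' j' hij' hj' => ?_, fun A _ c hc h0 => ?_⟩
    · induction i using Fin.lastCases with
      | last => exact absurd hij (not_lt.2 (Fin.le_last j))
      | cast i =>
      induction i' using Fin.lastCases with
      | last => exact absurd hij' (not_lt.2 (Fin.le_last j'))
      | cast i' =>
      induction j using Fin.lastCases with
      | last =>
        beta_reduce
        rw [hL2]
        induction j' using Fin.lastCases with
        | last =>
          have : (diff i'.castSucc (Fin.last _)).comp (adjoin.comp (meridianAt (base r) i)) =
              circlePath ((base r).1 i - (base r).1 i') (radius (base r) ((base r).1 i)) := by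
            ext1 t
            simp [diff, meridianAt, meridian, circlePath]
            ring
          rw [this]
          by_cases h : i = i'
          · simp only [h, sub_self, and_self, if_true]
            exact wind_circlePath (by exact_mod_cast (radius_pos _ _).ne')
          · simp only [Fin.castSucc_inj, h, false_and, if_false]
            refine wind_circlePath_eq_zero ?_
            rw [Complex.norm_of_nonneg (radius_pos _ _).le, norm_sub_rev]
            exact radius_lt _ fun e => h ((base r).2.1 e).symm
        | cast j' =>
          have : (diff i'.castSucc j'.castSucc).comp (adjoin.comp (meridianAt (base r) i)) =
              .const I (diff i' j' (base r)) := by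
            ext1 t
            simp [diff, meridianAt, meridian]
          rw [this, wind_const (diff_ne_zero (by simpa using hij') _), if_neg]
          exact fun h => (Fin.castSucc_lt_last j').ne h.2.symm
      | cast j =>
        beta_reduce
        rw [hL1]
        induction j' using Fin.lastCases with
        | last =>
          rw [if_neg fun h => (Fin.castSucc_lt_last j).ne h.2]
          refine wind_eq_zero_of_div_mem_slitPlane ?_ one_ne_zero fun t => Or.inl ?_
          · simp [hl]
          · simpa [diff] using! re_sec_sub_pos (l i j t) i'
        | cast j' =>
          have : (diff i'.castSucc j'.castSucc).comp (adjoin.comp (sec.comp (l i j))) =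
              (diff i' j').comp (l i j) := by
            ext1 t
            simp [diff, sec]
          rw [this, hdual i j (by simpa using hij) hj i' j' (by simpa using hij') hj']
          simp only [Fin.castSucc_inj]
    · have hT : IsExact fun γ : C(I, Total r) => c (adjoin.comp γ) := by
        refine (hc.pullback adjoin).isExact_total (base r) (fun i => ?_) ?_
        · rw [← hL2]
          exact h0 _ _ (Fin.castSucc_lt_last i) (by simp [Fin.lt_def])
        · refine hex A _ ((hc.pullback adjoin).pullback sec) fun i j hij hj => ?_
          rw [← hL1]
          exact h0 _ _ (by simpa using hij) hj
      obtain ⟨g, hg⟩ := hT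
      refine ⟨fun w => g (split w), fun γ => ?_⟩
      refine Eq.trans (congrArg c ?_) (hg (split.comp γ))
      exact ContinuousMap.ext fun t => (adjoin_split (γ t)).symm

end Conf

/-! ### Pairs of linearly independent vectors -/

/-- The pairs of linearly independent vectors. -/
def Frame (n : ℕ) : Set ((Fin (n + 1) → ℂ) × (Fin (n + 1) → ℂ)) :=
  {p | LinearIndependent ℂ ![p.1, p.2]}

namespace Frame

variable {n : ℕ}

lemma mem_iff {p : (Fin (n + 1) → ℂ) × (Fin (n + 1) → ℂ)} :
    p ∈ Frame n ↔ p.1 ≠ 0 ∧ p.2 ∉ span ℂ {p.1} := by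
  simp only [Frame, mem_ofPred_eq]
  rw [LinearIndependent.pair_symm_iff, linearIndependent_fin2, mem_span_singleton]
  simp

lemma isOpen : IsOpen (Frame n) :=
  (isOpen_setOfPred_linearIndependent (𝕜 := ℂ) (ι := Fin 2) (E := Fin (n + 1) → ℂ)).preimage
    (f := fun p : (Fin (n + 1) → ℂ) × (Fin (n + 1) → ℂ) => ![p.1, p.2])
    (continuous_pi fun i => by fin_cases i <;> simp <;> fun_prop)

lemma notMem_span_symm {u v : Fin (n + 1) → ℂ} (hv : v ≠ 0) (h : u ∉ span ℂ {v}) :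
    v ∉ span ℂ {u} := by
  have : (v, u) ∈ Frame n := mem_iff.2 ⟨hv, h⟩
  exact (mem_iff (p := (u, v)).1 (LinearIndependent.pair_symm_iff.1 this)).2

/-- A complex line as a real subspace. -/
abbrev line (u : Fin (n + 1) → ℂ) : Submodule ℝ (Fin (n + 1) → ℂ) :=
  (span ℂ {u}).restrictScalars ℝ

lemma finrank_line_add_two_lt (hn : 2 ≤ n) (u : Fin (n + 1) → ℂ) :
    finrank ℝ (line u) + 2 < finrank ℝ (Fin (n + 1) → ℂ) := by
  have h1 : finrank ℝ ℂ * finrank ℂ (span ℂ {u}) = finrank ℝ (span ℂ {u}) :=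
    finrank_mul_finrank ℝ ℂ _
  have h2 : finrank ℝ (line u) = finrank ℝ (span ℂ {u}) := rfl
  have h3 : finrank ℂ (span ℂ {u}) ≤ 1 := (finrank_span_le_card {u}).trans (by simp)
  rw [Complex.finrank_real_complex] at h1
  rw [finrank_pi_fintype]
  simp only [Complex.finrank_real_complex, Finset.sum_const, Finset.card_univ, Fintype.card_fin,
    smul_eq_mul]
  omega

lemma isPathConnected_compl_lines (hn : 2 ≤ n) {ι : Type*} [Finite ι]
    (e : ι → Fin (n + 1) → ℂ) : IsPathConnected {x | ∀ i, x ∉ span ℂ {e i}} :=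
  isPathConnected_compl_biUnion (fun i => line (e i)) fun i => by
    have := finrank_line_add_two_lt hn (e i)
    omega

lemma ne_zero_of_notMem {u v : Fin (n + 1) → ℂ} (h : u ∉ span ℂ {v}) : u ≠ 0 := by
  rintro rfl
  exact h (zero_mem _)

/-- The independent pairs whose first member avoids finitely many lines are joined. -/
lemma joinedIn (hn : 2 ≤ n) {ι : Type*} [Finite ι] (e : ι → Fin (n + 1) → ℂ)
    {p q : (Fin (n + 1) → ℂ) × (Fin (n + 1) → ℂ)}
    (hp : p ∈ Frame n ∧ ∀ i, p.1 ∉ span ℂ {e i}) (hq : q ∈ Frame n ∧ ∀ i, q.1 ∉ span ℂ {e i}) :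
    JoinedIn {p | p ∈ Frame n ∧ ∀ i, p.1 ∉ span ℂ {e i}} p q := by
  obtain ⟨u, v⟩ := p
  obtain ⟨u', v'⟩ := q
  obtain ⟨x, hx⟩ := (isPathConnected_compl_lines hn ![u, u']).nonempty
  have hx0 : x ∉ span ℂ {u} := hx 0
  have hx1 : x ∉ span ℂ {u'} := hx 1
  have vert : ∀ a b c : Fin (n + 1) → ℂ, a ≠ 0 → (∀ i, a ∉ span ℂ {e i}) → b ∉ span ℂ {a} →
      c ∉ span ℂ {a} →
      JoinedIn {p | p ∈ Frame n ∧ ∀ i, p.1 ∉ span ℂ {e i}} (a, b) (a, c) := by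
    intro a b c ha hae hb hc
    obtain ⟨γ, hγ⟩ := (isPathConnected_compl_lines hn fun _ : Unit => a).joinedIn b (fun _ => hb) c
      (fun _ => hc)
    exact ⟨γ.map (f := fun y => (a, y)) (by fun_prop), fun t =>
      ⟨mem_iff.2 ⟨ha, hγ t ()⟩, hae⟩⟩
  have horiz : JoinedIn {p | p ∈ Frame n ∧ ∀ i, p.1 ∉ span ℂ {e i}} (u, x) (u', x) := by
    obtain ⟨γ, hγ⟩ := (isPathConnected_compl_lines hn fun i : Option ι => i.elim x e).joinedIn u
      (fun i => by
        cases i with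
        | none => exact notMem_span_symm (mem_iff.1 hp.1).1 hx0
        | some i => exact hp.2 i) u'
      (fun i => by
        cases i with
        | none => exact notMem_span_symm (mem_iff.1 hq.1).1 hx1
        | some i => exact hq.2 i)
    exact ⟨γ.map (f := fun y => (y, x)) (by fun_prop), fun t => ⟨mem_iff.2
      ⟨ne_zero_of_notMem (hγ t none), notMem_span_symm (ne_zero_of_notMem hx0) (hγ t none)⟩,
      fun i => hγ t (some i)⟩⟩
  exact ((vert u v x (mem_iff.1 hp.1).1 hp.2 (mem_iff.1 hp.1).2 hx0).trans horiz).trans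
    (vert u' x v' (mem_iff.1 hq.1).1 hq.2 hx1 (mem_iff.1 hq.1).2)

lemma joinedIn_self (hn : 2 ≤ n) : ∀ p ∈ Frame n, ∀ q ∈ Frame n, JoinedIn (Frame n) p q := by
  intro p hp q hq
  exact (joinedIn hn (ι := Empty) Empty.elim ⟨hp, nofun⟩ ⟨hq, nofun⟩).mono fun _ h => h.1

/-- The standard independent pair. -/
lemma single_mem (hn : 2 ≤ n) : ((Pi.single 0 1, Pi.single 1 1) :
    (Fin (n + 1) → ℂ) × (Fin (n + 1) → ℂ)) ∈ Frame n := by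
  refine mem_iff.2 ⟨by simp, fun h => ?_⟩
  obtain ⟨a, ha⟩ := mem_span_singleton.1 h
  have := congrFun ha 1
  have h01 : (1 : Fin (n + 1)) ≠ 0 := by
    rw [Ne, Fin.ext_iff, Fin.val_one', Fin.val_zero, Nat.mod_eq_of_lt (by omega)]
    exact one_ne_zero
  simp [h01] at this

variable {A : Type*} [AddCommGroup A]

lemma exactOn_notMem_line (hn : 2 ≤ n) {c : C(I, Frame n) → A} (hc : IsCocycle c)
    {e : Fin (n + 1) → ℂ} (he : e ≠ 0) : ExactOn c {p | p.1.1 ∉ span ℂ {e}} := by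
  classical
  let B : Set (Fin (n + 1) → ℂ) := {u | u ∉ span ℂ {e}}
  let E : Set (B × (Fin (n + 1) → ℂ)) := {x | (x.1.1, x.2) ∈ Frame n}
  have hE : IsOpen E := isOpen.preimage (by fun_prop)
  let m : C(E, Frame n) := ⟨fun x => ⟨(x.1.1.1, x.1.2), x.2⟩, by fun_prop⟩
  have hcone : ∀ b : B, b.1 ≠ 0 := fun b => ne_zero_of_notMem b.2
  have hfib : ∀ (b : B) (f : Fin (n + 1) → ℂ), (b, f) ∈ E ↔ f ∉ span ℂ {b.1} := fun b f =>
    mem_iff.trans (and_iff_right (hcone b))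
  let sec : C(B, E) := ⟨fun b => ⟨(b, e), (hfib b e).2 (notMem_span_symm he b.2)⟩, by fun_prop⟩
  obtain ⟨g, hg⟩ := (hc.pullback m).exists_eq_section_add hE sec (fun _ => rfl)
    (fun b f hf f' hf' => by
      refine ((isPathConnected_compl_lines hn fun _ : Unit => b.1).joinedIn f
        (fun _ => (hfib b f).1 hf) f' (fun _ => (hfib b f').1 hf')).mono fun y hy => ?_
      exact (hfib b y).2 (hy ()))
    (fun b => by
      obtain ⟨g, hg⟩ := (((hc.pullback m).pullback
        ⟨fun y : {y | y ∉ line b.1} => ⟨(b, y.1), (hfib b y.1).2 y.2⟩,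
          by fun_prop⟩)).isExact_compl_submodule (line b.1) (finrank_line_add_two_lt hn b.1)
      exact ⟨fun y => g ⟨y.1, (hfib b y.1).1 y.2⟩, fun γ =>
        hg ⟨fun t => ⟨(γ t).1, (hfib b (γ t).1).1 (γ t).2⟩, by fun_prop⟩⟩)
  obtain ⟨h, hh⟩ := ((hc.pullback m).pullback sec).isExact_compl_submodule (line e)
    (finrank_line_add_two_lt hn e)
  refine ⟨fun p => if hp : p.1.1 ∈ B then h ⟨p.1.1, hp⟩ + g ⟨(⟨p.1.1, hp⟩, p.1.2), p.2⟩ else 0,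
    fun γ hγ => ?_⟩
  have e1 := hg ⟨fun t => ⟨(⟨(γ t).1.1, hγ t⟩, (γ t).1.2), (γ t).2⟩, by fun_prop⟩
  have e2 := hh ⟨fun t => ⟨(γ t).1.1, hγ t⟩, by fun_prop⟩
  simp only [show ∀ t, (γ t).1.1 ∈ B from hγ, dif_pos]
  refine Eq.trans (Eq.trans (congrArg c ?_) e1) ?_
  · rfl
  · refine Eq.trans (congrArg (· + _) e2) ?_
    simp only [ContinuousMap.coe_mk]
    abel

/-- Every cocycle on the space of independent pairs is exact. -/
theorem isExact (hn : 2 ≤ n) {c : C(I, Frame n) → A} (hc : IsCocycle c) : IsExact c := by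
  have hs := single_mem hn
  set e : Fin (n + 1) → ℂ := Pi.single 0 1
  set e' : Fin (n + 1) → ℂ := Pi.single 1 1
  have hopen : ∀ a : Fin (n + 1) → ℂ, IsOpen {p : Frame n | p.1.1 ∉ span ℂ {a}} := fun a =>
    ((span ℂ {a}).closed_of_finiteDimensional.isOpen_compl).preimage
      (continuous_fst.comp continuous_subtype_val)
  refine (hc.exactOn_union (hopen e) (hopen e') (exactOn_notMem_line hn hc (mem_iff.1 hs).1)
    (exactOn_notMem_line hn hc (ne_zero_of_notMem (mem_iff.1 hs).2)) ?_).isExact ?_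
  · rintro p ⟨hp1, hp2⟩ q ⟨hq1, hq2⟩
    refine (joinedIn hn ![e, e'] ⟨p.2, ?_⟩ ⟨q.2, ?_⟩).subtype
      fun z hz => ⟨hz.1, hz.2 0, hz.2 1⟩
    · intro i; fin_cases i
      exacts [hp1, hp2]
    · intro i; fin_cases i
      exacts [hq1, hq2]
  · intro p
    by_contra h
    simp only [mem_union, mem_ofPred_eq, not_or, not_not] at h
    have hp : p.1.1 ≠ 0 := (mem_iff.1 p.2).1
    obtain ⟨a, ha⟩ := mem_span_singleton.1 h.1
    have ha0 : a ≠ 0 := by rintro rfl; exact hp (by rw [← ha, zero_smul])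
    have h2 : e ∈ span ℂ {e'} := by
      rw [← inv_smul_smul₀ ha0 e, ha]
      exact smul_mem _ _ h.2
    exact notMem_span_symm (mem_iff.1 hs).1 (mem_iff.1 hs).2 h2

end Frame

/-! ### Projective coordinates -/

section Projective

variable {n : ℕ}

lemma isOpenQuotientMap_projectivization_mk : IsOpenQuotientMap
    fun v : {v : Fin (n + 1) → ℂ // v ≠ 0} => (Projectivization.mk ℂ v.1 v.2 : CP n) := by
  have hq : IsQuotientMap
      fun v : {v : Fin (n + 1) → ℂ // v ≠ 0} => (Projectivization.mk ℂ v.1 v.2 : CP n) :=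
    isQuotientMap_quot_mk
  refine .of_isOpenMap_isQuotientMap (fun U hU => hq.isOpen_preimage.1 ?_) hq
  have : (fun v : {v : Fin (n + 1) → ℂ // v ≠ 0} => (Projectivization.mk ℂ v.1 v.2 : CP n)) ⁻¹'
      ((fun v => Projectivization.mk ℂ v.1 v.2) '' U) =
      ⋃ a : ℂˣ, {v | (⟨a • v.1, (smul_ne_zero_iff_ne a).2 v.2⟩ :
        {v : Fin (n + 1) → ℂ // v ≠ 0}) ∈ U} := by
    ext v
    simp only [mem_preimage, mem_image, mem_iUnion, mem_ofPred_eq]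
    constructor
    · rintro ⟨u, hu, huv⟩
      obtain ⟨a, ha⟩ := (Projectivization.mk_eq_mk_iff ℂ _ _ u.2 v.2).1 huv
      exact ⟨a, by convert hu⟩
    · rintro ⟨a, ha⟩
      exact ⟨_, ha, (Projectivization.mk_eq_mk_iff ℂ _ _ _ _).2 ⟨a, rfl⟩⟩
  rw [this]
  refine isOpen_iUnion fun a => hU.preimage ?_
  fun_prop

/-- The affine chart in which the coordinate `j` is `1`. -/
def chart (j : Fin (n + 1)) (ξ : CP n) : Fin (n + 1) → ℂ := (ξ.rep j)⁻¹ • ξ.rep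

lemma chart_mk (j : Fin (n + 1)) {v : Fin (n + 1) → ℂ} (hv : v ≠ 0) :
    chart j (Projectivization.mk ℂ v hv) = (v j)⁻¹ • v := by
  obtain ⟨a, ha⟩ := Projectivization.exists_smul_eq_mk_rep ℂ v hv
  rw [chart, ← ha, Units.smul_def, Pi.smul_apply, smul_smul, smul_eq_mul, mul_inv_rev, mul_assoc,
    inv_mul_cancel₀ a.ne_zero, mul_one]

lemma rep_mk_ne_zero_iff (j : Fin (n + 1)) {v : Fin (n + 1) → ℂ} (hv : v ≠ 0) :
    (Projectivization.mk ℂ v hv).rep j ≠ 0 ↔ v j ≠ 0 := by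
  obtain ⟨a, ha⟩ := Projectivization.exists_smul_eq_mk_rep ℂ v hv
  rw [← ha, Units.smul_def, Pi.smul_apply, smul_eq_mul]
  simp

lemma isOpen_rep_ne_zero (j : Fin (n + 1)) : IsOpen {ξ : CP n | ξ.rep j ≠ 0} := by
  refine isOpenQuotientMap_projectivization_mk.isQuotientMap.isOpen_preimage.1 ?_
  have : (fun v : {v : Fin (n + 1) → ℂ // v ≠ 0} => (Projectivization.mk ℂ v.1 v.2 : CP n)) ⁻¹'
      {ξ : CP n | ξ.rep j ≠ 0} = {v | v.1 j ≠ 0} := by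
    ext v
    exact rep_mk_ne_zero_iff j v.2
  rw [this]
  exact isOpen_ne_fun ((continuous_apply j).comp continuous_subtype_val) continuous_const

lemma continuousAt_chart (j : Fin (n + 1)) {ξ : CP n} (hξ : ξ.rep j ≠ 0) :
    ContinuousAt (chart j) ξ := by
  obtain ⟨v, hv, rfl⟩ : ∃ v, ∃ hv : v ≠ 0, Projectivization.mk ℂ v hv = ξ :=
    ⟨ξ.rep, ξ.rep_nonzero, ξ.mk_rep⟩
  refine (isOpenQuotientMap_projectivization_mk.continuousAt_comp_iff (x := ⟨v, hv⟩)).1 ?_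
  simp only [Function.comp_def, chart_mk]
  refine ContinuousAt.smul (ContinuousAt.inv₀
    ((continuous_apply j).comp continuous_subtype_val).continuousAt ?_)
    continuous_subtype_val.continuousAt
  exact (rep_mk_ne_zero_iff j hv).1 hξ

lemma chart_ne_zero {j : Fin (n + 1)} {ξ : CP n} (hξ : ξ.rep j ≠ 0) : chart j ξ ≠ 0 :=
  smul_ne_zero (inv_ne_zero hξ) ξ.rep_nonzero

lemma mk_chart {j : Fin (n + 1)} {ξ : CP n} (hξ : ξ.rep j ≠ 0) :
    Projectivization.mk ℂ (chart j ξ) (chart_ne_zero hξ) = ξ := by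
  conv_rhs => rw [← ξ.mk_rep]
  exact (Projectivization.mk_eq_mk_iff' ℂ _ _ _ _).2 ⟨_, rfl⟩

/-- A minor of two vectors. -/
def minor (j k : Fin (n + 1)) (y z : Fin (n + 1) → ℂ) : ℂ := y j * z k - y k * z j

lemma exists_minor_ne_zero {u v : Fin (n + 1) → ℂ} (h : (u, v) ∈ Frame n) :
    ∃ j k, minor j k u v ≠ 0 := by
  obtain ⟨hu, hv⟩ := Frame.mem_iff.1 h
  obtain ⟨j, hj⟩ := Function.ne_iff.1 hu
  by_contra! hm
  refine hv (mem_span_singleton.2 ⟨v j / u j, funext fun k => ?_⟩)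
  have := hm j k
  simp only [minor] at this
  simp only [Pi.smul_apply, smul_eq_mul, Pi.zero_apply] at hj ⊢
  field_simp
  linear_combination -this

end Projective

/-! ### Collinear configurations -/

section Collinear

variable {r n : ℕ}

lemma span_range_rep {k : ℕ} (x : Fin k → CP n) :
    span ℂ (range fun j => (x j).rep) = ⨆ j, (x j).submodule := by
  rw [span_range_eq_iSup]
  simp only [Projectivization.submodule_eq]

lemma frame_combination_ne_zero {u v : Fin (n + 1) → ℂ} (h : (u, v) ∈ Frame n) (a : ℂ) :
    u + a • v ≠ 0 := fun h0 => by
  have := (LinearIndependent.pair_iff.1 h 1 a (by simpa using h0)).1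
  exact one_ne_zero this

lemma frame_coeff {u v : Fin (n + 1) → ℂ} (h : (u, v) ∈ Frame n) {a b a' b' : ℂ}
    (he : a • u + b • v = a' • u + b' • v) : a = a' ∧ b = b' := by
  have := LinearIndependent.pair_iff.1 h (a - a') (b - b') (by
    rw [sub_smul, sub_smul, sub_add_sub_comm, he, sub_self])
  exact ⟨sub_eq_zero.1 this.1, sub_eq_zero.1 this.2⟩

/-- Parameters of collinear configurations. -/
def Param (r n : ℕ) : Set (Conf r × ((Fin (n + 1) → ℂ) × (Fin (n + 1) → ℂ))) :=
  {y | y.2 ∈ Frame n}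

lemma isOpen_param : IsOpen (Param r n) := Frame.isOpen.preimage continuous_snd

/-- The collinear configuration with given parameters. -/
def paramFun (y : Param r n) : Fin (r + 3) → CP n :=
  Fin.cons (Projectivization.mk ℂ y.1.2.2 (Frame.ne_zero_of_notMem (Frame.mem_iff.1 y.2).2))
    fun i => Projectivization.mk ℂ (y.1.2.1 + y.1.1.1 i • y.1.2.2)
      (frame_combination_ne_zero y.2 _)

lemma paramFun_mem (y : Param r n) : paramFun y ∈ Fconf (r + 3) 1 n := by
  obtain ⟨⟨w, u, v⟩, h⟩ := y
  have h' : (u, v) ∈ Frame n := h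
  refine ⟨Fin.cons_injective_iff.2 ⟨?_, fun i j hij => ?_⟩, ?_⟩
  · rintro ⟨i, hi⟩
    obtain ⟨a, ha⟩ := (Projectivization.mk_eq_mk_iff' ℂ _ _ _ _).1 hi
    have := (frame_coeff h' (a := 1) (b := w.1 i) (a' := 0) (b' := a) (by simpa using ha.symm)).1
    exact one_ne_zero this
  · obtain ⟨a, ha⟩ := (Projectivization.mk_eq_mk_iff' ℂ _ _ _ _).1 hij
    have := frame_coeff h' (a := a) (b := a * w.1 j) (a' := 1) (b' := w.1 i)
      (by simpa [mul_smul] using ha)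
    refine (w.2.1 ?_).symm
    rw [← this.2, this.1, one_mul]
  · have hspan : ⨆ j, (paramFun ⟨⟨w, u, v⟩, h⟩ j).submodule = span ℂ (range ![u, v]) := by
      refine le_antisymm (iSup_le fun j => ?_) (span_le.2 ?_)
      · have hu : u ∈ span ℂ (range ![u, v]) := subset_span ⟨0, rfl⟩
        have hv : v ∈ span ℂ (range ![u, v]) := subset_span ⟨1, rfl⟩
        refine Fin.cases ?_ (fun i => ?_) j
        · simpa [paramFun] using hv
        · simp only [paramFun, Fin.cons_succ, Projectivization.submodule_mk, span_le,
            singleton_subset_iff]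
          exact add_mem hu (smul_mem _ _ hv)
      · rintro _ ⟨i, rfl⟩
        fin_cases i
        · refine le_iSup (fun j => (paramFun ⟨⟨w, u, v⟩, h⟩ j).submodule) (Fin.succ 0) ?_
          simp [paramFun, w.2.2.1, mem_span_singleton_self]
        · refine le_iSup (fun j => (paramFun ⟨⟨w, u, v⟩, h⟩ j).submodule) 0 ?_
          simp [paramFun, mem_span_singleton_self]
    rw [span_range_rep, hspan, finrank_span_eq_card h']
    simp

/-- The parametrization of the collinear configurations. -/
def param : C(Param r n, Fconf (r + 3) 1 n) :=
  ⟨fun y => ⟨paramFun y, paramFun_mem y⟩, by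
    have hmk : ∀ (f : Param r n → Fin (n + 1) → ℂ) (hf : Continuous f) (h0 : ∀ y, f y ≠ 0),
        Continuous fun y => (Projectivization.mk ℂ (f y) (h0 y) : CP n) := fun f hf h0 =>
      isOpenQuotientMap_projectivization_mk.continuous.comp (hf.subtype_mk h0)
    refine Continuous.subtype_mk (continuous_pi fun j => ?_) _
    refine Fin.cases ?_ (fun i => ?_) j
    · exact hmk (fun y => y.1.2.2) (by fun_prop) _
    · exact hmk (fun y => y.1.2.1 + y.1.1.1 i • y.1.2.2) (by fun_prop) _⟩

lemma eq_smul_of_param_eq {y y' : Param r n} (h : param y = param y') :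
    y.1.1 = y'.1.1 ∧ ∃ a : ℂ, a ≠ 0 ∧ y'.1.2 = a • y.1.2 := by
  obtain ⟨⟨w, u, v⟩, hy⟩ := y
  obtain ⟨⟨w', u', v'⟩, hy'⟩ := y'
  have hF : (u, v) ∈ Frame n := hy
  have h1 : paramFun ⟨⟨w, u, v⟩, hy⟩ = paramFun ⟨⟨w', u', v'⟩, hy'⟩ := congrArg Subtype.val h
  have hv : ∃ b : ℂ, b • v = v' :=
    (Projectivization.mk_eq_mk_iff' ℂ _ _ _ _).1 (congrFun h1 0).symm
  have hs : ∀ i, ∃ a : ℂ, a • (u + w.1 i • v) = u' + w'.1 i • v' := fun i =>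
    (Projectivization.mk_eq_mk_iff' ℂ _ _ _ _).1 (congrFun h1 i.succ).symm
  obtain ⟨b, rfl⟩ := hv
  obtain ⟨a, ha⟩ := hs 0
  rw [w.2.2.1, w'.2.2.1, zero_smul, zero_smul, add_zero, add_zero] at ha
  subst ha
  obtain ⟨d, hd⟩ := hs 1
  rw [w.2.2.2, w'.2.2.2, one_smul, one_smul, smul_add] at hd
  obtain ⟨rfl, rfl⟩ := frame_coeff hF hd
  have hd0 : d ≠ 0 := by
    rintro rfl
    exact (Frame.mem_iff.1 hy').1 (zero_smul _ _)
  refine ⟨Subtype.ext (funext fun i => ?_), d, hd0, rfl⟩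
  obtain ⟨e, he⟩ := hs i
  obtain ⟨rfl, h2⟩ := frame_coeff hF (a := e) (b := e * w.1 i) (a' := d) (b' := w'.1 i * d)
    (by simpa [mul_smul] using he)
  refine mul_left_cancel₀ hd0 (h2.trans (mul_comm _ _))

end Collinear

section Sections

variable {r n : ℕ}

lemma mem_frame_of_mk_ne {u v : Fin (n + 1) → ℂ} (hu : u ≠ 0) (hv : v ≠ 0)
    (h : Projectivization.mk ℂ u hu ≠ Projectivization.mk ℂ v hv) : (u, v) ∈ Frame n := by
  refine Frame.mem_iff.2 ⟨hu, fun hv' => h ?_⟩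
  obtain ⟨a, ha⟩ := mem_span_singleton.1 hv'
  exact ((Projectivization.mk_eq_mk_iff' ℂ _ _ _ _).2 ⟨a, ha⟩).symm

lemma exists_coeff (x : Fconf (r + 3) 1 n) {P : Fin (r + 3) → Fin (n + 1) → ℂ}
    (hP0 : ∀ i, P i ≠ 0) (hP : ∀ i, Projectivization.mk ℂ (P i) (hP0 i) = x.1 i)
    (i : Fin (r + 3)) : ∃ a b : ℂ, a • P 1 + b • P 0 = P i := by
  have hF : (P 1, P 0) ∈ Frame n := mem_frame_of_mk_ne (hP0 1) (hP0 0) (by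
    rw [hP, hP]
    exact fun h => one_ne_zero (x.2.1 h))
  have hmem : ∀ i, P i ∈ ⨆ j, (x.1 j).submodule := fun i => by
    refine le_iSup (fun j => (x.1 j).submodule) i ?_
    simp only [← hP, Projectivization.submodule_mk, mem_span_singleton_self]
  have hle : span ℂ (range ![P 1, P 0]) ≤ ⨆ j, (x.1 j).submodule := span_le.2 (by
    rintro _ ⟨i, rfl⟩
    fin_cases i
    · exact hmem 1
    · exact hmem 0)
  have heq := eq_of_le_of_finrank_eq hle (by
    rw [← span_range_rep, x.2.2, finrank_span_eq_card hF]
    simp)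
  have := hmem i
  rw [← heq, Matrix.range_cons, Matrix.range_cons, Matrix.range_empty, union_empty,
    singleton_union] at this
  exact mem_span_pair.1 this

/-- The coordinate, on the line through the first two vectors, of the point spanned by the
vector `i`. -/
def lineCoord (j k : Fin (n + 1)) (P : Fin (r + 3) → Fin (n + 1) → ℂ) (i : Fin (r + 3)) : ℂ :=
  minor j k (P i) (P 1) / minor j k (P 0) (P i)

lemma lineCoord_spec (x : Fconf (r + 3) 1 n) {P : Fin (r + 3) → Fin (n + 1) → ℂ}
    (hP0 : ∀ i, P i ≠ 0) (hP : ∀ i, Projectivization.mk ℂ (P i) (hP0 i) = x.1 i)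
    {j k : Fin (n + 1)} (hD : minor j k (P 0) (P 1) ≠ 0) {i : Fin (r + 3)} (hi : i ≠ 0) :
    minor j k (P 0) (P i) ≠ 0 ∧ ∃ a : ℂ, a • (P 1 + lineCoord j k P i • P 0) = P i := by
  obtain ⟨a, b, hab⟩ := exists_coeff x hP0 hP i
  have ha : a ≠ 0 := by
    rintro rfl
    refine hi (x.2.1 ?_)
    rw [← hP, ← hP]
    exact (Projectivization.mk_eq_mk_iff' ℂ _ _ _ _).2 ⟨b, by simpa using hab⟩
  have h1 : minor j k (P 0) (P i) = a * minor j k (P 0) (P 1) := by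
    simp only [← hab, minor, Pi.add_apply, Pi.smul_apply, smul_eq_mul]
    ring
  have h2 : minor j k (P i) (P 1) = b * minor j k (P 0) (P 1) := by
    simp only [← hab, minor, Pi.add_apply, Pi.smul_apply, smul_eq_mul]
    ring
  refine ⟨h1 ▸ mul_ne_zero ha hD, a, ?_⟩
  rw [← hab, lineCoord, h1, h2, smul_add, smul_smul, mul_div_mul_right _ _ hD,
    mul_div_cancel₀ _ ha]

lemma eq_of_lineCoord_eq (x : Fconf (r + 3) 1 n) {P : Fin (r + 3) → Fin (n + 1) → ℂ}
    (hP0 : ∀ i, P i ≠ 0) (hP : ∀ i, Projectivization.mk ℂ (P i) (hP0 i) = x.1 i)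
    {j k : Fin (n + 1)} (hD : minor j k (P 0) (P 1) ≠ 0) {i i' : Fin (r + 3)} (hi : i ≠ 0)
    (hi' : i' ≠ 0) (h : lineCoord j k P i = lineCoord j k P i') : i = i' := by
  obtain ⟨a, ha⟩ := (lineCoord_spec x hP0 hP hD hi).2
  obtain ⟨a', ha'⟩ := (lineCoord_spec x hP0 hP hD hi').2
  have ha0 : a' ≠ 0 := by
    rintro rfl
    exact hP0 i' (by rw [← ha', zero_smul])
  refine x.2.1 ?_
  rw [← hP, ← hP]
  refine (Projectivization.mk_eq_mk_iff' ℂ _ _ _ _).2 ⟨a / a', ?_⟩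
  rw [← ha', ← ha, h, smul_smul, div_mul_cancel₀ _ ha0]

lemma lineCoord_one {j k : Fin (n + 1)} (P : Fin (r + 3) → Fin (n + 1) → ℂ) :
    lineCoord j k P 1 = 0 := by
  simp [lineCoord, minor, mul_comm]

/-- The parametrization of collinear configurations has local sections. -/
lemma exists_local_section_param (x : Fconf (r + 3) 1 n) :
    ∃ U ∈ 𝓝 x, ∃ s : C(U, Param r n), ∀ u, param (s u) = u.1 := by
  have hex : ∀ i, ∃ j, (x.1 i).rep j ≠ 0 := fun i => Function.ne_iff.1 (x.1 i).rep_nonzero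
  choose c hc using hex
  let P : Fconf (r + 3) 1 n → Fin (r + 3) → Fin (n + 1) → ℂ := fun y i => chart (c i) (y.1 i)
  have heval : ∀ i, Continuous fun y : Fconf (r + 3) 1 n => y.1 i := fun i =>
    (continuous_apply i).comp continuous_subtype_val
  have hcont : ∀ i (y : Fconf (r + 3) 1 n), (y.1 i).rep (c i) ≠ 0 →
      ContinuousAt (fun y => P y i) y := fun i y hy =>
    (continuousAt_chart (c i) hy).comp (f := fun y : Fconf (r + 3) 1 n => y.1 i)
      (heval i).continuousAt
  have hF : (P x 0, P x 1) ∈ Frame n :=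
    mem_frame_of_mk_ne (chart_ne_zero (hc 0)) (chart_ne_zero (hc 1)) (by
      rw [mk_chart (hc 0), mk_chart (hc 1)]
      exact fun h => one_ne_zero (x.2.1 h).symm)
  obtain ⟨j, k, hD⟩ := exists_minor_ne_zero hF
  have hminor : ∀ {y z : Fconf (r + 3) 1 n → Fin (n + 1) → ℂ} {w : Fconf (r + 3) 1 n},
      ContinuousAt y w → ContinuousAt z w → ContinuousAt (fun w => minor j k (y w) (z w)) w :=
    fun hy hz => by
      have hyi := fun i => (continuous_apply i).continuousAt.comp hy
      have hzi := fun i => (continuous_apply i).continuousAt.comp hz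
      exact ((hyi j).mul (hzi k)).sub ((hyi k).mul (hzi j))
  let U : Set (Fconf (r + 3) 1 n) :=
    {y | (∀ i, (y.1 i).rep (c i) ≠ 0) ∧ minor j k (P y 0) (P y 1) ≠ 0}
  have hU : U ∈ 𝓝 x := by
    refine Filter.inter_mem (Filter.eventually_all.2 fun i => ?_)
      ((hminor (hcont 0 x (hc 0)) (hcont 1 x (hc 1))).eventually_ne hD)
    exact ((isOpen_rep_ne_zero (c i)).preimage
      (heval i)).mem_nhds (hc i)
  have hP0 : ∀ u : U, ∀ i, P u.1 i ≠ 0 := fun u i => chart_ne_zero (u.2.1 i)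
  have hP : ∀ u : U, ∀ i, Projectivization.mk ℂ (P u.1 i) (hP0 u i) = u.1.1 i :=
    fun u i => mk_chart (u.2.1 i)
  have hPc : ∀ i, Continuous fun u : U => P u.1 i := fun i =>
    continuous_iff_continuousAt.2 fun u =>
      (hcont i u.1 (u.2.1 i)).comp continuous_subtype_val.continuousAt
  have hm : ∀ i i', Continuous fun u : U => minor j k (P u.1 i) (P u.1 i') := fun i i' =>
    continuous_iff_continuousAt.2 fun u =>
      (hminor (hcont i u.1 (u.2.1 i)) (hcont i' u.1 (u.2.1 i'))).comp
        continuous_subtype_val.continuousAt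
  have hcoord : ∀ i : Fin (r + 2), Continuous fun u : U => lineCoord j k (P u.1) i.succ := fun i =>
    (hm _ _).div (hm _ _) fun u => (lineCoord_spec u.1 (hP0 u) (hP u) u.2.2 i.succ_ne_zero).1
  have hinj : ∀ u : U, ∀ i i' : Fin (r + 2),
      lineCoord j k (P u.1) i.succ = lineCoord j k (P u.1) i'.succ → i = i' := fun u i i' h =>
    Fin.succ_injective _ (eq_of_lineCoord_eq u.1 (hP0 u) (hP u) u.2.2 i.succ_ne_zero
      i'.succ_ne_zero h)
  have hs0 : ∀ u : U, lineCoord j k (P u.1) (Fin.succ 0) = 0 := fun u => lineCoord_one _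
  have hs1 : ∀ u : U, lineCoord j k (P u.1) (Fin.succ 1) ≠ 0 := fun u h =>
    one_ne_zero (hinj u 1 0 (h.trans (hs0 u).symm))
  let W : U → Conf r := fun u =>
    ⟨fun i => lineCoord j k (P u.1) i.succ / lineCoord j k (P u.1) (Fin.succ 1),
      fun i i' h => hinj u i i' ((div_left_inj' (hs1 u)).1 h),
      (div_eq_zero_iff.2 (.inl (hs0 u))), div_self (hs1 u)⟩
  have hW : Continuous W := Continuous.subtype_mk
    (continuous_pi fun i => (hcoord i).div (hcoord 1) hs1) _
  refine ⟨U, hU, ⟨fun u => ⟨(W u, P u.1 1, lineCoord j k (P u.1) (Fin.succ 1) • P u.1 0), ?_⟩, ?_⟩,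
    fun u => ?_⟩
  · refine mem_frame_of_mk_ne (hP0 u 1) (smul_ne_zero (hs1 u) (hP0 u 0)) fun h => ?_
    have h2 : Projectivization.mk ℂ _ (smul_ne_zero (hs1 u) (hP0 u 0)) =
        Projectivization.mk ℂ _ (hP0 u 0) :=
      (Projectivization.mk_eq_mk_iff' ℂ _ _ _ _).2 ⟨_, rfl⟩
    rw [h2, hP, hP] at h
    exact one_ne_zero (u.1.2.1 h)
  · exact (hW.prodMk ((hPc 1).prodMk ((hcoord 1).smul (hPc 0)))).subtype_mk _
  · refine Subtype.ext (funext fun i => ?_)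
    refine Fin.cases ?_ (fun i => ?_) i
    · exact ((Projectivization.mk_eq_mk_iff' ℂ _ _ _ _).2 ⟨_, rfl⟩).trans (hP u 0)
    · obtain ⟨a, ha⟩ := (lineCoord_spec u.1 (hP0 u) (hP u) u.2.2 i.succ_ne_zero).2
      refine Eq.trans ?_ (hP u i.succ)
      refine ((Projectivization.mk_eq_mk_iff' ℂ _ _ _ _).2 ⟨a, ?_⟩).symm
      rw [← ha]
      change a • (P u.1 1 + (lineCoord j k (P u.1) i.succ / lineCoord j k (P u.1) (Fin.succ 1)) •
        lineCoord j k (P u.1) (Fin.succ 1) • P u.1 0) = _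
      rw [smul_smul, div_mul_cancel₀ _ (hs1 u)]

lemma param_surjective : Function.Surjective (param : Param r n → Fconf (r + 3) 1 n) := fun x => by
  obtain ⟨U, hU, s, hs⟩ := exists_local_section_param x
  exact ⟨s ⟨x, mem_of_mem_nhds hU⟩, hs _⟩

/-- The cross-ratio coordinates of a collinear configuration. -/
lemma exists_coordinates : ∃ f : C(Fconf (r + 3) 1 n, Conf r), ∀ y : Param r n,
    f (param y) = y.1.1 := by
  choose g hg using (param_surjective (r := r) (n := n))
  have hfac : ∀ y : Param r n, (g (param y)).1.1 = y.1.1 := fun y =>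
    (eq_smul_of_param_eq (hg (param y))).1
  refine ⟨⟨fun x => (g x).1.1, continuous_iff_continuousAt.2 fun x => ?_⟩, hfac⟩
  obtain ⟨U, hU, s, hs⟩ := exists_local_section_param x
  have : ContinuousOn (fun x => (g x).1.1) U := continuousOn_iff_continuous_domRestrict.2 (by
    have : Continuous fun u => (s u).1.1 := by fun_prop
    refine this.congr fun u => ?_
    rw [domRestrict_apply, ← hs u, hfac])
  exact this.continuousAt hU

end Sections

section Exactness

variable {r n : ℕ} {A : Type*} [AddCommGroup A]

/-- The parameters with a fixed line. -/
def standardFrame (hn : 2 ≤ n) : C(Conf r, Param r n) :=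
  ⟨fun w => ⟨(w, (Pi.single 0 1, Pi.single 1 1)), Frame.single_mem hn⟩, by fun_prop⟩

lemma pathConnectedSpace_Fconf (hn : 2 ≤ n) : PathConnectedSpace (Fconf (r + 3) 1 n) := by
  have hj : ∀ y : Param r n, Joined y (standardFrame hn y.1.1) := fun y => by
    obtain ⟨p, hp⟩ := Frame.joinedIn_self hn y.1.2 y.2 _ (Frame.single_mem hn)
    exact ⟨⟨⟨fun t => ⟨(y.1.1, p t), hp t⟩, by fun_prop⟩,
      Subtype.ext (Prod.ext rfl p.source), Subtype.ext (Prod.ext rfl p.target)⟩⟩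
  refine ⟨⟨param (standardFrame hn (Conf.base r))⟩, fun x x' => ?_⟩
  obtain ⟨y, rfl⟩ := param_surjective x
  obtain ⟨y', rfl⟩ := param_surjective x'
  refine Joined.map ?_ param.continuous
  exact (hj y).trans (((PathConnectedSpace.joined _ _).map
    (standardFrame hn).continuous).trans (hj y').symm)

/-- A cocycle on the collinear configurations is exact if it is so on a family of collinear
configurations on a fixed line. -/
theorem IsCocycle.isExact_collinear (hn : 2 ≤ n) {c : C(I, Fconf (r + 3) 1 n) → A}
    (hc : IsCocycle c)
    (h : IsExact fun γ : C(I, Conf r) => c (param.comp ((standardFrame hn).comp γ))) :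
    IsExact c := by
  obtain ⟨f, hf⟩ := h
  obtain ⟨g, hg⟩ := (hc.pullback param).exists_eq_section_add isOpen_param (standardFrame hn)
    (fun _ => rfl) (fun _ => Frame.joinedIn_self hn) fun b =>
      Frame.isExact hn ((hc.pullback param).pullback
        ⟨fun p : Frame n => (⟨(b, p.1), p.2⟩ : Param r n), by fun_prop⟩)
  have hG : ∀ γ : C(I, Param r n), c (param.comp γ) =
      (f (γ 1).1.1 + g (γ 1)) - (f (γ 0).1.1 + g (γ 0)) := fun γ => by
    refine (hg γ).trans ?_
    rw [add_sub_add_comm]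
    exact congrArg (· + _) (hf _)
  refine hc.isExact_of_local_sections param param_surjective (fun y => f y.1.1 + g y) hG
    (fun y y' hyy => ?_) exists_local_section_param
  obtain ⟨h1, a, ha, h2⟩ := eq_smul_of_param_eq hyy
  have hmem : ∀ t : ℂ, Complex.exp t • y.1.2 ∈ Frame n := fun t =>
    (LinearIndependent.pair_smul_iff (Complex.exp_ne_zero t)).2 y.2
  let γ : C(I, Param r n) :=
    ⟨fun t => ⟨(y.1.1, Complex.exp ((t : ℝ) * Complex.log a) • y.1.2), hmem _⟩, by fun_prop⟩
  have h0 : γ 0 = y := Subtype.ext (Prod.ext rfl (by simp [γ]))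
  have h1 : γ 1 = y' := Subtype.ext (Prod.ext h1 (by simp [γ, Complex.exp_log ha, h2]))
  have hconst : param.comp γ = .const I (param y) := ContinuousMap.ext fun t =>
    Subtype.ext (funext fun i => by
      refine Fin.cases ?_ (fun i => ?_) i
      · exact (Projectivization.mk_eq_mk_iff' ℂ _ _ _ _).2 ⟨_, rfl⟩
      · refine (Projectivization.mk_eq_mk_iff' ℂ _ _ _ _).2
          ⟨Complex.exp ((t : ℝ) * Complex.log a), ?_⟩
        simp only [γ, ContinuousMap.coe_mk, Prod.smul_fst, Prod.smul_snd, smul_add]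
        rw [smul_comm])
  have := hG γ
  rw [hconst, hc.const, h0, h1] at this
  exact (sub_eq_zero.1 this.symm).symm

end Exactness

section Hurewicz

variable {X B : Type*} [TopologicalSpace X] [AddCommGroup B]

lemma IsCocycle.eq_of_homotopic {c : C(I, X) → B} (hc : IsCocycle c) {a b : X} {p q : Path a b}
    (h : p.Homotopic q) : c p = c q := by
  obtain ⟨F⟩ := h
  have := hc.square F.toContinuousMap
  have hb : F.toContinuousMap.comp edgeBottom = .const I a :=
    ContinuousMap.ext fun s => F.source s
  have ht : F.toContinuousMap.comp edgeTop = .const I b :=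
    ContinuousMap.ext fun s => F.target s
  have hl : F.toContinuousMap.comp edgeLeft = p := ContinuousMap.ext fun t => F.apply_zero t
  have hr : F.toContinuousMap.comp edgeRight = q := ContinuousMap.ext fun t => F.apply_one t
  rw [hb, ht, hl, hr, hc.const, hc.const, zero_add, add_zero] at this
  exact this.symm

lemma IsCocycle.trans {c : C(I, X) → B} (hc : IsCocycle c) {a b d : X} (p : Path a b)
    (q : Path b d) : c (p.trans q) = c p + c q := by
  have h1 : subpath (p.trans q) 0 (1 / 2) = p := ContinuousMap.ext fun s => by
    have hs : (0 : ℝ) + s * (1 / 2 - 0) ∈ I := ⟨by linarith [s.2.1], by linarith [s.2.2]⟩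
    have hs' : (0 : ℝ) + s * (1 / 2 - 0) ≤ 1 / 2 := by linarith [s.2.2]
    simp only [subpath, ContinuousMap.coe_mk, projIcc_of_mem zero_le_one hs]
    change (p.trans q) _ = p s
    rw [Path.trans_apply, dif_pos hs']
    exact congrArg p (Subtype.ext (by ring))
  have h2 : subpath (p.trans q) (1 / 2) 1 = q := ContinuousMap.ext fun s => by
    have hs : (1 / 2 : ℝ) + s * (1 - 1 / 2) ∈ I := ⟨by linarith [s.2.1], by linarith [s.2.2]⟩
    simp only [subpath, ContinuousMap.coe_mk, projIcc_of_mem zero_le_one hs]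
    change (p.trans q) _ = q s
    rw [Path.trans_apply]
    split_ifs with hs'
    · have : s = 0 := Subtype.ext (le_antisymm (by change (s : ℝ) ≤ 0; linarith) s.2.1)
      subst this
      simp
    · exact congrArg q (Subtype.ext (by ring))
  have := hc.subpath_add (p.trans q : C(I, X)) 0 (1 / 2) 1
  rw [h1, h2, subpath_zero_one] at this
  exact this.symm

lemma IsCocycle.refl {c : C(I, X) → B} (hc : IsCocycle c) (a : X) : c (Path.refl a) = 0 :=
  hc.const a

lemma IsCocycle.add_symm {c : C(I, X) → B} (hc : IsCocycle c) {a b : X} (p : Path a b) :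
    c p + c p.symm = 0 := by
  rw [← hc.trans, ← hc.refl a]
  exact hc.eq_of_homotopic ⟨(Path.Homotopy.reflTransSymm p).symm⟩

/-- The homomorphism on the fundamental group induced by a cocycle. -/
def IsCocycle.hom {c : C(I, X) → B} (hc : IsCocycle c) (x : X) :
    FundamentalGroup X x →* Multiplicative B where
  toFun g := .ofAdd (Quotient.lift (fun p : Path x x => c p) (fun _ _ => hc.eq_of_homotopic)
    g.toPath)
  map_one' := congrArg Multiplicative.ofAdd (hc.refl x)
  map_mul' g h := by
    induction g using Path.Homotopic.Quotient.ind with | mk p =>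
    induction h using Path.Homotopic.Quotient.ind with | mk q =>
    exact congrArg Multiplicative.ofAdd ((hc.trans q p).trans (add_comm _ _))

/-- The class of a path in the abelianized fundamental group, its ends being joined to the
base point by `α`. -/
def pathClass {x : X} (α : ∀ y, Path x y) {a b : X} (p : Path.Homotopic.Quotient a b) :
    Additive (Abelianization (FundamentalGroup X x)) :=
  .ofMul (Abelianization.of (FundamentalGroup.fromPath
    ((Path.Homotopic.Quotient.mk (α a)).trans
      (p.trans (Path.Homotopic.Quotient.mk (α b)).symm))))

lemma pathClass_trans {x : X} (α : ∀ y, Path x y) {a b d : X} (p : Path.Homotopic.Quotient a b)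
    (q : Path.Homotopic.Quotient b d) :
    pathClass α (p.trans q) = pathClass α p + pathClass α q := by
  rw [add_comm]
  unfold pathClass
  rw [← ofMul_mul, ← map_mul, FundamentalGroup.mul_def]
  congr 2
  change _ = Path.Homotopic.Quotient.trans (Path.Homotopic.Quotient.trans _ _) _
  simp only [Path.Homotopic.Quotient.trans_assoc]
  congr 2
  rw [← Path.Homotopic.Quotient.trans_assoc _ _ (q.trans _), Path.Homotopic.Quotient.symm_trans,
    Path.Homotopic.Quotient.refl_trans]

lemma pathClass_refl {x : X} (α : ∀ y, Path x y) (a : X) :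
    pathClass α (Path.Homotopic.Quotient.refl a) = 0 := by
  have := pathClass_trans α (Path.Homotopic.Quotient.refl a) (Path.Homotopic.Quotient.refl a)
  rw [Path.Homotopic.Quotient.refl_trans] at this
  exact left_eq_add.1 this

/-- At the base point, the connecting paths do not matter. -/
lemma pathClass_base {x : X} (α : ∀ y, Path x y) (p : Path.Homotopic.Quotient x x) :
    pathClass α p = .ofMul (Abelianization.of (FundamentalGroup.fromPath p)) := by
  have h : ∀ a g : FundamentalGroup X x, Abelianization.of (a⁻¹ * g * a) = Abelianization.of g :=
    fun a g => by rw [map_mul, map_mul, map_inv, mul_assoc, inv_mul_eq_iff_eq_mul, mul_comm]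
  exact congrArg Additive.ofMul
    (h (FundamentalGroup.fromPath (.mk (α x))) (FundamentalGroup.fromPath p))

instance contractibleSpace_square : ContractibleSpace (I × I) := by
  refine contractible_iff_id_nullhomotopic _ |>.2 ⟨(0, 0), ⟨⟨⟨fun p =>
    (unitInterval.symm p.1 * p.2.1, unitInterval.symm p.1 * p.2.2), by fun_prop⟩, ?_, ?_⟩⟩⟩
  · intro p
    simp
  · intro p
    simp

lemma isCocycle_pathClass {x : X} (α : ∀ y, Path x y) :
    IsCocycle fun γ : C(I, X) => pathClass α (.mk (⟨γ, rfl, rfl⟩ : Path (γ 0) (γ 1))) where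
  const a := pathClass_refl α a
  square H := by
    let b : Path ((0, 0) : I × I) (1, 0) := ⟨edgeBottom, rfl, rfl⟩
    let r : Path ((1, 0) : I × I) (1, 1) := ⟨edgeRight, rfl, rfl⟩
    let l : Path ((0, 0) : I × I) (0, 1) := ⟨edgeLeft, rfl, rfl⟩
    let t : Path ((0, 1) : I × I) (1, 1) := ⟨edgeTop, rfl, rfl⟩
    have h := (SimplyConnectedSpace.paths_homotopic (b.trans r) (l.trans t)).map H
    rw [Path.map_trans, Path.map_trans] at h
    have h' := congrArg (pathClass α) (Path.Homotopic.Quotient.eq.2 h)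
    rw [Path.Homotopic.Quotient.mk_trans, Path.Homotopic.Quotient.mk_trans, pathClass_trans,
      pathClass_trans] at h'
    exact h'

end Hurewicz

/-- If a space has loops dual to a finite family of integral cocycles and each cocycle which
vanishes on these loops is exact, then its first homology is free on the family. -/
theorem nonempty_abelianization_addEquiv {X P : Type} [TopologicalSpace X] [PathConnectedSpace X]
    [Fintype P] [DecidableEq P] (W : P → C(I, X) → ℤ) (hW : ∀ q, IsCocycle (W q))
    (l : P → C(I, X)) (hl : ∀ p, l p 0 = l p 1)
    (hdual : ∀ p q, W q (l p) = if p = q then 1 else 0)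
    (hex : ∀ (A : Type) [AddCommGroup A] (c : C(I, X) → A), IsCocycle c → (∀ p, c (l p) = 0) →
      IsExact c) (x : X) :
    Nonempty (Additive (Abelianization (FundamentalGroup X x)) ≃+ (P → ℤ)) := by
  let α : ∀ y, Path x y := fun y => PathConnectedSpace.somePath x y
  let c : C(I, X) → Additive (Abelianization (FundamentalGroup X x)) :=
    fun γ => pathClass α (.mk (⟨γ, rfl, rfl⟩ : Path (γ 0) (γ 1)))
  have hc : IsCocycle c := isCocycle_pathClass α
  have hformula : ∀ γ : C(I, X), γ 0 = γ 1 → c γ = ∑ q, W q γ • c (l q) := fun γ hγ => by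
    have := hex _ _ (hc.sub (.sum Finset.univ fun q _ => (hW q).smul (c (l q)))) fun p => by
      simp [hdual]
    exact sub_eq_zero.1 (this.loop_eq_zero hγ)
  have hWpi : IsCocycle fun γ q => W q γ :=
    ⟨fun a => funext fun q => (hW q).const a, fun H => funext fun q => (hW q).square H⟩
  let φ : Additive (Abelianization (FundamentalGroup X x)) →+ (P → ℤ) :=
    MonoidHom.toAdditiveLeft (Abelianization.lift (hWpi.hom x))
  have hφ : ∀ p : Path x x, φ (.ofMul (Abelianization.of (FundamentalGroup.fromPath (.mk p)))) =
      fun q => W q p := fun p => rfl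
  have hφc : ∀ γ : C(I, X), γ 0 = γ 1 → φ (c γ) = fun q => W q γ := fun γ hγ => by
    refine (hφ ((α (γ 0)).trans ((⟨γ, rfl, rfl⟩ : Path (γ 0) (γ 1)).trans
      (α (γ 1)).symm))).trans (funext fun q => ?_)
    rw [(hW q).trans, (hW q).trans, ← congrArg (fun y => W q (α y).symm) hγ]
    have := (hW q).add_symm (α (γ 0))
    change _ + (W q γ + _) = W q γ
    linear_combination this
  refine ⟨AddEquiv.ofBijective φ
    ⟨Function.LeftInverse.injective (g := fun f => ∑ q, f q • c (l q)) fun g => ?_,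
      fun f => ⟨∑ q, f q • c (l q), ?_⟩⟩⟩
  · obtain ⟨g, rfl⟩ := Additive.ofMul.surjective g
    obtain ⟨g, rfl⟩ := QuotientGroup.mk_surjective g
    obtain ⟨p, rfl⟩ := Path.Homotopic.Quotient.mk_surjective g
    have h := hformula p (p.source.trans p.target.symm)
    have hp : ∀ {a b : X} (p : Path a b), c p = pathClass α (.mk p) := by
      rintro a b ⟨γ, h0, h1⟩
      subst h0 h1
      rfl
    rw [hp, pathClass_base] at h
    exact h.symm
  · rw [map_sum]
    simp only [map_zsmul, hφc _ (hl _), hdual]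
    ext q
    simp

lemma card_pairs (r : ℕ) :
    Fintype.card {p : Fin (r + 2) × Fin (r + 2) // p.1 < p.2 ∧ 1 < p.2} =
      (r + 2).choose 2 - 1 := by
  have hin : ∀ j : Fin (r + 2), (∑ i : Fin (r + 2), if i < j ∧ 1 < j then 1 else 0) =
      if 1 < (j : ℕ) then (j : ℕ) else 0 := fun j => by
    have h1 : (1 < j) ↔ 1 < (j : ℕ) := by simp [Fin.lt_def]
    by_cases h : 1 < (j : ℕ)
    · simp [h1, h, Finset.filter_gt_eq_Iio]
    · simp [h1, h]
  rw [Fintype.card_subtype, Finset.card_filter, Fintype.sum_prod_type_right]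
  simp only [hin]
  clear hin
  rw [Fin.sum_univ_eq_sum_range (fun j => if 1 < j then j else 0)]
  induction r with
  | zero => decide
  | succ r ih =>
    rw [Finset.sum_range_succ, ih, if_pos (by omega), Nat.choose_succ_succ' (r + 2) 1,
      Nat.choose_one_right, one_add_one_eq_two]
    have : 0 < (r + 2).choose 2 := Nat.choose_pos (by omega)
    omega

end FirstHomology

/-- For `k ≥ 3` and `n ≥ 2`, the abelianization of `π₁(F_{k+1}^{1,n})` (the first homology
group of this path-connected space) is the free abelian group `ℤ^(C(k,2) - 1)`. -/
theorem H1_Fconf_one_n (k n : ℕ) (hk : 3 ≤ k) (hn : 2 ≤ n) (x : Fconf (k + 1) 1 n) :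
    Nonempty (Additive (Abelianization (FundamentalGroup (Fconf (k + 1) 1 n) x)) ≃+
      (Fin (k.choose 2 - 1) → ℤ)) := by
  obtain ⟨r, rfl⟩ : ∃ r, k = r + 2 := ⟨k - 2, by omega⟩
  have := pathConnectedSpace_Fconf (r := r) hn
  obtain ⟨f, hf⟩ := exists_coordinates (r := r) (n := n)
  obtain ⟨l, hl, hdual, hex⟩ := Conf.exists_dual_loops r
  have hpull : ∀ i j i' j', ((Conf.diff i j).comp f).comp
      (param.comp ((standardFrame hn).comp (l i' j'))) = (Conf.diff i j).comp (l i' j') :=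
    fun i j i' j' => ContinuousMap.ext fun t => congrArg (Conf.diff i j) (hf _)
  obtain ⟨e⟩ := nonempty_abelianization_addEquiv
    (P := {p : Fin (r + 2) × Fin (r + 2) // p.1 < p.2 ∧ 1 < p.2})
    (fun q γ => wind (((Conf.diff q.1.1 q.1.2).comp f).comp γ))
    (fun q => isCocycle_wind _ fun y => Conf.diff_ne_zero q.2.1 (f y))
    (fun p => param.comp ((standardFrame hn).comp (l p.1.1 p.1.2)))
    (fun p => congrArg (fun w => param (standardFrame hn w)) (hl _ _))
    (fun p q => by
      rw [hpull, hdual _ _ p.2.1 p.2.2 _ _ q.2.1 q.2.2]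
      simp only [Subtype.ext_iff, Prod.ext_iff])
    (fun A _ c hc hv => hc.isExact_collinear hn
      (hex A _ (hc.pullback (param.comp (standardFrame hn))) fun i j hij hj =>
        hv ⟨(i, j), hij, hj⟩))
    x
  exact ⟨e.trans (AddEquiv.arrowCongr (Fintype.equivFinOfCardEq (card_pairs r)) (.refl ℤ))⟩
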